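/- arXiv:2511.04911 — 9 statements merged into one kernel-verified Lean document; each statement's English description precedes it below -/
import Mathlib

section
/- Let p be a prime and let F be a field of characteristic p with subfields k ⊆ K ⊆ F. If A ⊆ K is separably independent over k and B ⊆ K is algebraically independent over the subfield k(A) generated by A over k (and A, B are disjoint), then A ∪ B is separably independent over k. -/
/-- The subfield generated by a subfield `k` and a subset `S` of the ambient field,
denoted `k(S)`. -/
def Subfield.adjoinSet {F : Type*} [Field F] (k : Subfield F) (S : Set F) : Subfield F :=
  Subfield.closure (↑k ∪ S)

/-- A subset `S` of an ambient field `F` is separably independent over a subfield `k`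
if no element `s ∈ S` is separably algebraic over the subfield `k(S ∖ {s})`. -/
def SepIndepOver {F : Type*} [Field F] (k : Subfield F) (S : Set F) : Prop :=
  ∀ s ∈ S, ¬ IsSeparable (k.adjoinSet (S \ {s})) s

/-- A subset `B` of an ambient field `F` is algebraically independent over a subfield `k₀`
if no element `b ∈ B` is algebraic over the subfield `k₀(B ∖ {b})`. -/
def AlgIndepOver {F : Type*} [Field F] (k₀ : Subfield F) (B : Set F) : Prop :=
  ∀ b ∈ B, ¬ IsAlgebraic (k₀.adjoinSet (B \ {b})) b

open Polynomial in
/-- An element `a` lying in the field generated by `a ^ p` is separable. -/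
theorem isSeparable_of_mem_adjoin_pow {k F : Type*} [Field k] [Field F] [Algebra k F]
    (p : ℕ) [CharP k p] {a : F} (h : a ∈ IntermediateField.adjoin k {a ^ p}) :
    IsSeparable k a := by
  obtain ⟨r, s, hrs⟩ := (IntermediateField.mem_adjoin_simple_iff k a).1 h
  by_cases hs : aeval (a ^ p) s = 0
  · rw [hs, div_zero] at hrs
    rw [hrs, ← map_zero (algebraMap k F)]
    exact isSeparable_algebraMap _
  set P : k[X] := X * expand k p s - expand k p r with hP
  have hP0 : aeval a P = 0 := by
    simp only [hP, map_sub, map_mul, aeval_X, expand_aeval]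
    nth_rw 1 [hrs]
    rw [div_mul_cancel₀ _ hs, sub_self]
  have hP' : aeval a (derivative P) ≠ 0 := by
    simpa [hP, derivative_expand, expand_aeval] using hs
  have hPne : P ≠ 0 := by
    intro h0
    simp [h0] at hP'
  have hint : IsIntegral k a := IsAlgebraic.isIntegral ⟨P, hPne, hP0⟩
  refine (separable_iff_derivative_ne_zero (minpoly.irreducible hint)).2 fun h0 ↦ hP' ?_
  obtain ⟨Q, hQ⟩ := minpoly.dvd k a hP0
  rw [hQ, derivative_mul, h0]
  simp

open MvPolynomial in
/-- If a family is algebraically independent over `M`, then an element of `M` lying in the field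
generated over a subfield `L` by the family already lies in `L`. -/
theorem AlgebraicIndependent.mem_range_of_mem_adjoin {L M F ι : Type*} [Field L] [Field M] [Field F]
    [Algebra L M] [Algebra M F] [Algebra L F] [IsScalarTower L M F] {x : ι → F}
    (hx : AlgebraicIndependent M x) {a : M}
    (ha : algebraMap M F a ∈ IntermediateField.adjoin L (Set.range x)) :
    a ∈ Set.range (algebraMap L M) := by
  obtain ⟨r, s, hrs⟩ := (IntermediateField.mem_adjoin_range_iff L x _).1 ha
  by_cases hs : aeval x s = 0
  · rw [hs, div_zero] at hrs
    exact ⟨0, by rw [map_zero, (map_eq_zero _).1 hrs]⟩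
  have h : C a * MvPolynomial.map (algebraMap L M) s - MvPolynomial.map (algebraMap L M) r = 0 := by
    refine (algebraicIndependent_iff.1 hx) _ ?_
    rw [map_sub, map_mul, aeval_map_algebraMap, aeval_map_algebraMap, aeval_C, hrs,
      div_mul_cancel₀ _ hs, sub_self]
  obtain ⟨n, hn⟩ := ne_zero_iff.1 (show s ≠ 0 by rintro rfl; simp at hs)
  have hc := congrArg (coeff n) h
  rw [coeff_sub, coeff_C_mul, coeff_map, coeff_map, coeff_zero, sub_eq_zero] at hc
  refine ⟨coeff n r / coeff n s, ?_⟩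
  rw [map_div₀, ← hc, mul_div_cancel_right₀ _ ((map_ne_zero _).2 hn)]

namespace Subfield

variable {F : Type*} [Field F] {k k' : Subfield F}

theorem isAlgebraic_of_le (h : k ≤ k') {x : F} (hx : IsAlgebraic k x) : IsAlgebraic k' x := by
  let := (inclusion h).toAlgebra
  have : IsScalarTower k k' F := .of_algebraMap_eq fun _ ↦ rfl
  exact hx.tower_top k'

theorem toSubfield_adjoin (k : Subfield F) (S : Set F) :
    (IntermediateField.adjoin k S).toSubfield = k.adjoinSet S := by
  rw [IntermediateField.adjoin_toSubfield]
  congr 2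
  exact Subtype.range_coe

theorem mem_adjoin_iff_mem_adjoinSet {S : Set F} {x : F} :
    x ∈ IntermediateField.adjoin k S ↔ x ∈ k.adjoinSet S := by
  rw [← toSubfield_adjoin]
  rfl

theorem adjoinSet_adjoinSet (k : Subfield F) (S T : Set F) :
    (k.adjoinSet S).adjoinSet T = k.adjoinSet (S ∪ T) := by
  simp only [adjoinSet, closure_union, closure_eq, ← sup_assoc]

theorem adjoinSet_mono (h : k ≤ k') {S T : Set F} (hST : S ⊆ T) :
    k.adjoinSet S ≤ k'.adjoinSet T :=
  closure_mono (Set.union_subset_union h hST)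

theorem subset_adjoinSet (k : Subfield F) (S : Set F) : S ⊆ k.adjoinSet S :=
  fun _ hx ↦ subset_closure (Or.inr hx)

end Subfield

theorem AlgIndepOver.algebraicIndependent {F : Type*} [Field F] {k : Subfield F} {B : Set F}
    (h : AlgIndepOver k B) : AlgebraicIndependent k ((↑) : B → F) := by
  refine algebraicIndependent_of_finite' B (algebraMap k F).injective
    fun t htB _ _ b hb hbt halg ↦ h b hb ?_
  have h1 : IsAlgebraic (IntermediateField.adjoin k t).toSubfield b :=
    IntermediateField.isAlgebraic_adjoin_iff.2 halg
  refine Subfield.isAlgebraic_of_le ?_ h1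
  rw [Subfield.toSubfield_adjoin]
  exact Subfield.adjoinSet_mono le_rfl (Set.subset_sdiff_singleton htB hbt)

/-- Adjoining a set that is algebraically independent over `k(a)` does not affect whether `a` is
separable. -/
theorem AlgIndepOver.isSeparable_of_isSeparable_adjoinSet {p : ℕ} (hp : p.Prime)
    {F : Type*} [Field F] [CharP F p] {k M : Subfield F} (hkM : k ≤ M) {B : Set F} {a : F}
    (haM : a ∈ M) (hB : AlgIndepOver M B) (ha : IsSeparable (k.adjoinSet B) a) :
    IsSeparable k a := by
  have := Fact.mk hp
  have : CharP k p := (algebraMap k F).charP (algebraMap k F).injective p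
  have : CharP (k.adjoinSet B) p := (algebraMap (k.adjoinSet B) F).charP (RingHom.injective _) p
  have h1 : a ∈ (k.adjoinSet B).adjoinSet {a ^ p} := by
    rw [← Subfield.mem_adjoin_iff_mem_adjoinSet,
      ← IntermediateField.adjoin_simple_eq_adjoin_pow_expChar_of_isSeparable _ _ ha p]
    exact IntermediateField.mem_adjoin_simple_self _ a
  rw [Subfield.adjoinSet_adjoinSet, Set.union_comm, ← Subfield.adjoinSet_adjoinSet] at h1
  have hLM : k.adjoinSet {a ^ p} ≤ M := Subfield.closure_le.2 <|
    Set.union_subset hkM (Set.singleton_subset_iff.2 (pow_mem haM p))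
  let := (Subfield.inclusion hLM).toAlgebra
  have : IsScalarTower (k.adjoinSet {a ^ p}) M F := .of_algebraMap_eq fun _ ↦ rfl
  obtain ⟨y, hy⟩ := hB.algebraicIndependent.mem_range_of_mem_adjoin (L := k.adjoinSet {a ^ p})
    (a := ⟨a, haM⟩) (by
      rw [Subtype.range_coe]
      exact Subfield.mem_adjoin_iff_mem_adjoinSet.2 h1)
  have hya : (y : F) = a := congrArg Subtype.val hy
  refine isSeparable_of_mem_adjoin_pow p (Subfield.mem_adjoin_iff_mem_adjoinSet.2 ?_)
  have hy' := y.2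
  rwa [hya] at hy'

/-- If `A ⊆ K` is separably independent over `k` and `B ⊆ K` is algebraically independent
over `k(A)`, with `A` and `B` disjoint, then `A ∪ B` is separably independent over `k`. -/
theorem sepIndep_union_of_sepIndep_of_algIndep
    {p : ℕ} (hp : p.Prime) {F : Type*} [Field F] [CharP F p]
    (k K : Subfield F) (hkK : k ≤ K) (A B : Set F)
    (hA : A ⊆ (K : Set F)) (hB : B ⊆ (K : Set F)) (hAB : Disjoint A B)
    (hsep : SepIndepOver k A) (halg : AlgIndepOver (k.adjoinSet A) B) :
    SepIndepOver k (A ∪ B) := by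
  rintro s (hs | hs) h
  · have hsB : s ∉ B := Set.disjoint_left.1 hAB hs
    rw [Set.union_sdiff_distrib, Set.sdiff_singleton_eq_self hsB,
      ← Subfield.adjoinSet_adjoinSet] at h
    exact hsep s hs <| halg.isSeparable_of_isSeparable_adjoinSet hp
      (Subfield.adjoinSet_mono le_rfl Set.sdiff_subset) (Subfield.subset_adjoinSet k A hs) h
  · have hsA : s ∉ A := Set.disjoint_right.1 hAB hs
    rw [Set.union_sdiff_distrib, Set.sdiff_singleton_eq_self hsA,
      ← Subfield.adjoinSet_adjoinSet] at h
    exact halg s hs h.isIntegral.isAlgebraic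
end

section
/- Let p be a prime, let k ⊆ K be an extension of fields of characteristic p, and let A be a subset of K. Then A is separably independent over k if and only if A is p-independent in the subfield k(A) over k, i.e., no a ∈ A lies in the subfield k(A)^p · k(A∖{a}). -/
/-- A subset `S` of a subfield `M` is `p`-independent in `M` over a subfield `k₀ ⊆ M`
if no `s ∈ S` lies in the subfield `M^p · k₀(S ∖ {s})`. -/
def PIndepOver {F : Type*} [Field F] (p : ℕ) (k₀ M : Subfield F) (S : Set F) : Prop :=
  ∀ s ∈ S,
    s ∉ Subfield.closure ((fun x : F => x ^ p) '' (M : Set F) ∪ ↑k₀ ∪ (S \ {s}))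

open Polynomial in
/-- A simple root of some polynomial over `L` is separable over `L`. -/
theorem isSeparable_of_aeval_derivative_ne_zero {L E : Type*} [Field L] [Field E] [Algebra L E]
    {a : E} (q : L[X]) (hq : aeval a q = 0) (hq' : aeval a (derivative q) ≠ 0) :
    IsSeparable L a := by
  have hne : q ≠ 0 := by
    rintro rfl
    simp at hq'
  have hint : IsIntegral L a := isAlgebraic_iff_isIntegral.mp ⟨q, hne, hq⟩
  obtain ⟨h, rfl⟩ := minpoly.dvd L a hq
  refine (separable_iff_derivative_ne_zero (minpoly.irreducible hint)).mpr fun h0 => hq' ?_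
  simp [h0, derivative_mul]

open Polynomial IntermediateField in
/-- In characteristic `p`, an element `a` is separable over `L` if and only if it lies
in `L(a ^ p)`. -/
theorem isSeparable_iff_mem_adjoin_pow {L E : Type*} [Field L] [Field E] [Algebra L E]
    (p : ℕ) (hp : p.Prime) [CharP L p] (a : E) :
    IsSeparable L a ↔ a ∈ L⟮a ^ p⟯ := by
  have : Fact p.Prime := ⟨hp⟩
  have : ExpChar L p := ExpChar.prime hp
  constructor
  · intro h
    rw [← adjoin_simple_eq_adjoin_pow_expChar_of_isSeparable L E h p]
    exact mem_adjoin_simple_self L a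
  · intro h
    obtain ⟨r, s, hrs⟩ := mem_adjoin_simple_iff L a |>.mp h
    by_cases hs : aeval (a ^ p) s = 0
    · rw [hs, div_zero] at hrs
      subst hrs
      simpa using isSeparable_algebraMap (K := E) (0 : L)
    · refine isSeparable_of_aeval_derivative_ne_zero (X * expand L p s - expand L p r) ?_ ?_
      · rw [eq_div_iff hs] at hrs
        simp [expand_aeval, hrs]
      · simpa [derivative_expand, expand_aeval] using hs

/-- Adjoining to `k(S ∖ {a})` the `p`-th powers of `k(S)` amounts to adjoining `a ^ p`. -/
theorem Subfield.closure_pow_image_adjoinSet {F : Type*} [Field F] {p : ℕ} (hp : p.Prime)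
    [CharP F p] (k : Subfield F) {S : Set F} {a : F} (ha : a ∈ S) :
    Subfield.closure ((fun x : F => x ^ p) '' (k.adjoinSet S : Set F) ∪ ↑k ∪ (S \ {a})) =
      (IntermediateField.adjoin (k.adjoinSet (S \ {a})) {a ^ p}).toSubfield := by
  have : Fact p.Prime := ⟨hp⟩
  set N := (IntermediateField.adjoin (k.adjoinSet (S \ {a})) {a ^ p}).toSubfield with hN
  have hL : k.adjoinSet (S \ {a}) ≤ N := fun x hx =>
    (IntermediateField.adjoin (k.adjoinSet (S \ {a})) {a ^ p}).algebraMap_mem ⟨x, hx⟩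
  have hk : (k : Set F) ⊆ N := fun x hx => hL (Subfield.subset_closure (.inl hx))
  have hS : S \ {a} ⊆ (N : Set F) := fun x hx => hL (Subfield.subset_closure (.inr hx))
  have haN : a ^ p ∈ N := IntermediateField.mem_adjoin_simple_self (k.adjoinSet (S \ {a})) _
  apply le_antisymm
  · have hM : k.adjoinSet S ≤ N.comap (frobenius F p) := by
      refine Subfield.closure_le.mpr ?_
      rintro x (hx | hx)
      · exact pow_mem (hk hx) p
      · by_cases hxa : x = a
        · subst hxa
          exact haN
        · exact pow_mem (hS ⟨hx, hxa⟩) p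
    refine Subfield.closure_le.mpr (Set.union_subset (Set.union_subset ?_ hk) hS)
    rintro _ ⟨x, hx, rfl⟩
    exact hM hx
  · rw [hN, IntermediateField.adjoin_toSubfield, Subfield.closure_le]
    rintro x (⟨y, rfl⟩ | rfl)
    · refine Subfield.closure_mono ?_ y.2
      rintro z (hz | hz)
      · exact .inl (.inr hz)
      · exact .inr hz
    · exact Subfield.subset_closure (.inl (.inl ⟨a, Subfield.subset_closure (.inr ha), rfl⟩))

/-- `A` is separably independent over `k` if and only if `A` is `p`-independent
in the subfield `k(A)` over `k`. -/
theorem sepIndepOver_iff_pIndepOver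
    {p : ℕ} (hp : p.Prime) {F : Type*} [Field F] [CharP F p]
    (k K : Subfield F) (hkK : k ≤ K) (A : Set F) (hA : A ⊆ (K : Set F)) :
    SepIndepOver k A ↔ PIndepOver p k (k.adjoinSet A) A := by
  refine forall₂_congr fun a ha => not_congr ?_
  rw [Subfield.closure_pow_image_adjoinSet hp k ha]
  exact isSeparable_iff_mem_adjoin_pow p hp a
end

section
/- Let p be a prime and let k ⊆ K and k ⊆ L be subfields of an ambient field F of characteristic p such that both extensions k ⊆ K and k ⊆ L are separable. If K is algebraically independent from L over k, then the extension K ⊆ KL of K by the compositum KL inside F is separable. -/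
/-- The subfield of `p`-th powers of a subfield `K`. -/
def Subfield.pPow {F : Type*} [Field F] (p : ℕ) (K : Subfield F) : Subfield F :=
  Subfield.closure ((fun x : F => x ^ p) '' (K : Set F))

/-- `K₁` is linearly disjoint from `K₂` over a common subfield `k₀`: every subset of `K₁`
which is `k₀`-linearly independent remains `K₂`-linearly independent. -/
def LinDisjOver {F : Type*} [Field F] (k₀ K₁ K₂ : Subfield F) : Prop :=
  ∀ S : Set F, S ⊆ (K₁ : Set F) →
    LinearIndependent k₀ (Subtype.val : S → F) →
    LinearIndependent K₂ (Subtype.val : S → F)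

/-- The extension `k ⊆ K` (in characteristic `p`) is separable if `k` is linearly
disjoint from `K^p` over `k^p`. -/
def SepExt {F : Type*} [Field F] (p : ℕ) (k K : Subfield F) : Prop :=
  LinDisjOver (k.pPow p) k (K.pPow p)

/-- `K` is algebraically independent (free) from `L` over `k`: every subset of `K`
algebraically independent over `k` remains algebraically independent over `L`. -/
def AlgIndepFrom {F : Type*} [Field F] (k K L : Subfield F) : Prop :=
  ∀ S : Set F, S ⊆ (K : Set F) → AlgIndepOver k S → AlgIndepOver L S

theorem Subfield.mem_pPow {p : ℕ} {F : Type*} [Field F] [ExpChar F p]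
    {A : Subfield F} {x : F} : x ∈ A.pPow p ↔ ∃ y ∈ A, y ^ p = x := by
  have h : A.pPow p = A.map (frobenius F p) := by
    refine le_antisymm (Subfield.closure_le.2 ?_) fun x hx ↦ ?_
    · rintro _ ⟨y, hy, rfl⟩
      exact ⟨y, hy, rfl⟩
    · obtain ⟨y, hy, rfl⟩ := hx
      exact Subfield.subset_closure ⟨y, hy, rfl⟩
  rw [h]
  rfl

/-- The elements of the finite set `s` are linearly independent over the `p`-th powers of
elements of `A`. -/
def PowIndep {F : Type*} [Field F] (p : ℕ) (A : Subfield F) (s : Finset F) : Prop :=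
  ∀ a : F → F, (∀ x ∈ s, a x ∈ A) → ∑ x ∈ s, a x ^ p * x = 0 → ∀ x ∈ s, a x = 0

theorem linearIndepOn_finset_iff_forall_mem {F : Type*} [Field F] (A : Subfield F)
    (s : Finset F) (f : F → F) : LinearIndepOn A f (s : Set F) ↔
      ∀ c : F → F, (∀ x ∈ s, c x ∈ A) → ∑ x ∈ s, c x * f x = 0 → ∀ x ∈ s, c x = 0 := by
  classical
  rw [linearIndepOn_finset_iff]
  constructor
  · intro h c hc h0 x hx
    have := h (fun x ↦ if hx : x ∈ s then ⟨c x, hc x hx⟩ else 0) (by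
      rw [← h0]
      refine Finset.sum_congr rfl fun y hy ↦ ?_
      simp [hy, Subfield.smul_def]) x hx
    simpa [hx, Subtype.ext_iff] using this
  · intro h g h0 x hx
    exact Subtype.ext (h (fun x ↦ g x) (fun x _ ↦ (g x).2) h0 x hx)

theorem powIndep_iff {F : Type*} [Field F] {p : ℕ} [ExpChar F p] (A : Subfield F)
    (s : Finset F) : PowIndep p A s ↔ LinearIndepOn (A.pPow p) id (s : Set F) := by
  have hp := expChar_ne_zero F p
  rw [linearIndepOn_finset_iff_forall_mem]
  constructor
  · intro h c hc h0 x hx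
    choose! b hb hbc using fun x hx ↦ Subfield.mem_pPow.1 (hc x hx)
    rw [← hbc x hx, h b hb _ x hx, zero_pow hp]
    rw [← h0]
    exact Finset.sum_congr rfl fun y hy ↦ by simp [hbc y hy]
  · intro h a ha h0 x hx
    exact eq_zero_of_pow_eq_zero
      (h (fun x ↦ a x ^ p) (fun x hx ↦ Subfield.mem_pPow.2 ⟨_, ha x hx, rfl⟩) h0 x hx)

theorem linearIndependent_subtype_iff_finset {F : Type*} [Field F] (A : Subfield F) (S : Set F) :
    LinearIndependent A (Subtype.val : S → F) ↔
      ∀ s : Finset F, (s : Set F) ⊆ S → LinearIndepOn A id (s : Set F) := by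
  refine ⟨fun h s hs ↦ LinearIndepOn.mono (v := id) (s := S) h hs, fun h ↦ ?_⟩
  change LinearIndepOn A id S
  exact linearIndepOn_of_finite S fun t ht hft ↦ by
    simpa using h hft.toFinset (by simpa using ht)

theorem sepExt_iff {F : Type*} [Field F] {p : ℕ} [ExpChar F p] {k K : Subfield F} :
    SepExt p k K ↔ ∀ s : Finset F, (s : Set F) ⊆ k → PowIndep p k s → PowIndep p K s := by
  simp only [SepExt, LinDisjOver, linearIndependent_subtype_iff_finset, powIndep_iff]
  refine ⟨fun h s hs hk ↦ h s hs (fun t ht ↦ hk.mono ht) s subset_rfl, fun h S hS hk t ht ↦ ?_⟩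
  exact h t (ht.trans hS) (hk t ht)

theorem SepExt.linearIndepOn_pow {F : Type*} [Field F] {p : ℕ} [ExpChar F p] {k L : Subfield F}
    (h : SepExt p k L) (hkL : k ≤ L) {s : Finset F} (hs : (s : Set F) ⊆ L)
    (hk : LinearIndepOn k id (s : Set F)) : LinearIndepOn k (· ^ p) (s : Set F) := by
  classical
  rw [linearIndepOn_finset_iff_forall_mem] at hk ⊢
  intro c hc h0
  obtain ⟨b, hb, hspan, hind⟩ := exists_linearIndependent (k.pPow p) (c '' s)
  have hfin : b.Finite := (s.finite_toSet.image c).subset hb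
  lift b to Finset F using hfin
  have hbk : (b : Set F) ⊆ k := hb.trans (by rintro _ ⟨x, hx, rfl⟩; exact hc x hx)
  have hbL : PowIndep p L b := sepExt_iff.1 h b hbk ((powIndep_iff _ _).2 hind)
  have hrep : ∀ x ∈ s, ∃ r : F → F, (∀ y, r y ∈ k) ∧ c x = ∑ y ∈ b, r y ^ p * y := by
    intro x hx
    have hmem : c x ∈ Submodule.span (k.pPow p) (b : Set F) :=
      hspan ▸ Submodule.subset_span ⟨x, hx, rfl⟩
    obtain ⟨f, -, hf⟩ := Submodule.mem_span_finset.1 hmem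
    choose r hr hrf using fun y ↦ Subfield.mem_pPow.1 (f y).2
    exact ⟨r, hr, by rw [← hf]; simp [hrf, Subfield.smul_def]⟩
  choose! r hr hrc using hrep
  have hzero : ∀ y ∈ b, ∑ x ∈ s, r x y * x = 0 := by
    refine hbL (fun y ↦ ∑ x ∈ s, r x y * x) (fun y _ ↦ sum_mem fun x hx ↦
      mul_mem (hkL (hr x hx y)) (hs hx)) ?_
    rw [← h0]
    simp only [sum_pow_char, Finset.sum_mul]
    rw [Finset.sum_comm]
    refine Finset.sum_congr rfl fun x hx ↦ ?_
    rw [hrc x hx, Finset.sum_mul]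
    exact Finset.sum_congr rfl fun y _ ↦ by ring
  intro x hx
  rw [hrc x hx]
  refine Finset.sum_eq_zero fun y hy ↦ ?_
  rw [hk (fun x ↦ r x y) (fun x hx ↦ hr x hx y) (hzero y hy) x hx,
    zero_pow (expChar_ne_zero F p), zero_mul]

theorem AlgebraicIndependent.of_isTranscendenceBasis_left {k K L F ι κ : Type*} [Field k]
    [Field K] [Field L] [Field F] [Algebra k K] [Algebra k L] [Algebra k F] [Algebra K F]
    [Algebra L F] [IsScalarTower k K F] [IsScalarTower k L F] {s : ι → K}
    (hs : IsTranscendenceBasis k s) (hsL : AlgebraicIndependent L (algebraMap K F ∘ s))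
    {t : κ → L} (ht : AlgebraicIndependent k t) :
    AlgebraicIndependent K (algebraMap L F ∘ t) := by
  have h1 := (AlgebraicIndependent.sumElim_comp ht hsL).comp _ (Equiv.sumComm κ ι).injective
  have h2 : AlgebraicIndependent k (Sum.elim (algebraMap L F ∘ t) (algebraMap K F ∘ s)) := by
    convert h1 using 1
    ext (x | x) <;> rfl
  have h3 := (AlgebraicIndependent.sumElim_iff.1 h2).2
  have := hs.isAlgebraic
  suffices AlgebraicIndependent (Algebra.adjoin k (Set.range s)) (algebraMap L F ∘ t) from
    this.extendScalars K
  refine h3.of_ringHom_of_comp_eq (S := Algebra.adjoin k (Set.range (algebraMap K F ∘ s)))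
    (((IsScalarTower.toAlgHom k K F).comp (Algebra.adjoin k (Set.range s)).val).codRestrict
      _ ?_) (RingHom.id F) ?_ ?_
  · intro x
    have := (IsScalarTower.toAlgHom k K F).map_adjoin (Set.range s)
    rw [← Set.range_comp] at this
    exact this.le ⟨x.1, x.2, rfl⟩
  · intro x y h
    exact Subtype.ext ((algebraMap K F).injective congr($(h).1))
  · rfl

theorem Subfield.adjoinSet_eq_toSubfield_adjoin {F : Type*} [Field F] (k : Subfield F)
    (S : Set F) : k.adjoinSet S = (IntermediateField.adjoin k S).toSubfield := by
  rw [Subfield.adjoinSet, IntermediateField.adjoin_toSubfield]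
  congr 2
  exact Subtype.range_coe.symm

theorem Subfield.isAlgebraic_adjoinSet_iff {F : Type*} [Field F] {k : Subfield F}
    {S : Set F} {x : F} :
    IsAlgebraic (k.adjoinSet S) x ↔ IsAlgebraic (Algebra.adjoin k S) x := by
  rw [← IntermediateField.isAlgebraic_adjoin_iff, Subfield.adjoinSet_eq_toSubfield_adjoin]
  exact Iff.rfl

theorem algebraicIndependent_subtype_iff_not_isAlgebraic {k F : Type*} [Field k] [Field F]
    [Algebra k F] {S : Set F} : AlgebraicIndependent k ((↑) : S → F) ↔
      ∀ b ∈ S, ¬ IsAlgebraic (Algebra.adjoin k (S \ {b})) b := by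
  refine ⟨fun h b hb ↦ ?_, fun h ↦ algebraicIndependent_of_finite' S (algebraMap k F).injective
    fun t htS _ _ a ha hat hal ↦ h a ha ?_⟩
  · have := h.transcendental_adjoin (i := ⟨b, hb⟩) (s := {⟨b, hb⟩}ᶜ) (by simp)
    have himg : ((↑) : S → F) '' {⟨b, hb⟩}ᶜ = S \ {b} := by
      ext x
      simp
    rw [himg] at this
    exact this
  · have hle : Algebra.adjoin k t ≤ Algebra.adjoin k (S \ {a}) :=
      Algebra.adjoin_mono fun x hx ↦ ⟨htS hx, fun hxa ↦ hat (hxa ▸ hx)⟩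
    exact hal.ringHom_of_comp_eq (Subalgebra.inclusion hle) (RingHom.id F)
      (Subalgebra.inclusion_injective hle) rfl

theorem algIndepOver_iff {F : Type*} [Field F] {k : Subfield F} {S : Set F} :
    AlgIndepOver k S ↔ AlgebraicIndependent k ((↑) : S → F) := by
  rw [algebraicIndependent_subtype_iff_not_isAlgebraic]
  exact forall₂_congr fun b _ ↦ not_congr Subfield.isAlgebraic_adjoinSet_iff

theorem AlgIndepFrom.algebraicIndependent {F κ : Type*} [Field F] {k K L : Subfield F}
    (hkK : k ≤ K) (hkL : k ≤ L) (h : AlgIndepFrom k K L) {t : κ → F} (htL : ∀ i, t i ∈ L)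
    (ht : AlgebraicIndependent k t) : AlgebraicIndependent K t := by
  let : Algebra k K := (Subfield.inclusion hkK).toAlgebra
  let : Algebra k L := (Subfield.inclusion hkL).toAlgebra
  have : IsScalarTower k K F := .of_algebraMap_eq fun _ ↦ rfl
  have : IsScalarTower k L F := .of_algebraMap_eq fun _ ↦ rfl
  obtain ⟨s, hs⟩ := exists_isTranscendenceBasis k K
  have hsF : AlgebraicIndependent k (algebraMap K F ∘ ((↑) : s → K)) :=
    hs.1.map' (f := IsScalarTower.toAlgHom k K F) (algebraMap K F).injective
  have hsL : AlgebraicIndependent L (algebraMap K F ∘ ((↑) : s → K)) := by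
    have := algIndepOver_iff.1 <| h (Set.range (algebraMap K F ∘ ((↑) : s → K)))
      (by rintro _ ⟨x, rfl⟩; exact x.1.2)
      (algIndepOver_iff.2 (AlgebraicIndependent.coe_range hsF))
    exact (algebraicIndependent_subtype_range
      ((algebraMap K F).injective.comp Subtype.val_injective)).1 this
  exact AlgebraicIndependent.of_isTranscendenceBasis_left hs hsL (t := fun i ↦ ⟨t i, htL i⟩)
    (.of_comp (IsScalarTower.toAlgHom k L F) ht)

theorem MvPolynomial.coeff_smul_pow_char {σ R : Type*} [CommSemiring R] (p : ℕ) [ExpChar R p]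
    (f : MvPolynomial σ R) (m : σ →₀ ℕ) : (f ^ p).coeff (p • m) = f.coeff m ^ p := by
  rw [← MvPolynomial.map_frobenius_expand, MvPolynomial.coeff_map,
    MvPolynomial.coeff_expand_smul _ (expChar_ne_zero R p)]
  rfl

open scoped IntermediateField.algebraAdjoinAdjoin in
theorem PowIndep.adjoin_of_algebraicIndependent {F ι : Type*} [Field F] {p : ℕ} [ExpChar F p]
    {K : Subfield F} {s : Finset F} (hsK : ∀ x ∈ s, x ∈ K) (hs : PowIndep p K s) {t : ι → F}
    (ht : AlgebraicIndependent K t) :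
    PowIndep p (IntermediateField.adjoin K (Set.range t)).toSubfield s := by
  classical
  have : ExpChar K p := (algebraMap K F).expChar (algebraMap K F).injective p
  have hp := expChar_ne_zero F p
  intro a ha h0
  obtain ⟨⟨d, hd⟩, hda⟩ := IsLocalization.exist_integer_multiples
    (nonZeroDivisors (Algebra.adjoin K (Set.range t)))
    s (fun x ↦ if hx : x ∈ s then (⟨a x, ha x hx⟩ : IntermediateField.adjoin K (Set.range t))
      else 0)
  have hd0 : (d : F) ≠ 0 := fun h ↦ nonZeroDivisors.ne_zero hd (Subtype.ext h)
  have hrep : ∀ x ∈ s, ∃ f : MvPolynomial ι K, MvPolynomial.aeval t f = d * a x := by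
    intro x hx
    obtain ⟨y, hy⟩ := hda x hx
    obtain ⟨f, hf⟩ := (Algebra.adjoin_range_eq_range_aeval K t).le y.2
    refine ⟨f, hf.trans ?_⟩
    simpa [hx, Algebra.smul_def] using congr((($hy : IntermediateField.adjoin K _) : F))
  choose! f hf using hrep
  have hterm : ∀ x ∈ s.attach, MvPolynomial.aeval t (MvPolynomial.C ⟨x.1, hsK x x.2⟩ * f x ^ p) =
      (d : F) ^ p * (a x ^ p * x) := by
    intro x _
    rw [map_mul, map_pow, hf x x.2, MvPolynomial.aeval_C, mul_pow, mul_comm, mul_assoc]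
    rfl
  have hsum : ∑ x ∈ s.attach, MvPolynomial.C ⟨x.1, hsK x x.2⟩ * f x ^ p = 0 := by
    refine ht ?_
    rw [map_sum, map_zero, Finset.sum_congr rfl hterm,
      Finset.sum_attach s (fun x ↦ (d : F) ^ p * (a x ^ p * x)), ← Finset.mul_sum, h0, mul_zero]
  have hcoeff : ∀ m, ∀ x ∈ s, (((f x).coeff m : K) : F) = 0 := fun m ↦ by
    refine hs _ (fun x _ ↦ ((f x).coeff m).2) ?_
    have := congr(((MvPolynomial.coeff (p • m) $hsum : K) : F))
    rw [MvPolynomial.coeff_sum] at this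
    simp only [MvPolynomial.coeff_C_mul, MvPolynomial.coeff_smul_pow_char] at this
    rw [← Finset.sum_attach]
    simpa [mul_comm] using this
  intro x hx
  have hfx : f x = 0 := MvPolynomial.ext _ _ fun m ↦ Subtype.ext (hcoeff m x hx)
  have := hf x hx
  rw [hfx, map_zero] at this
  exact (mul_eq_zero.1 this.symm).resolve_left hd0

theorem PowIndep.of_isSeparable {F : Type*} [Field F] {p : ℕ} [ExpChar F p]
    {M : Subfield F} (N : IntermediateField M F) [Algebra.IsSeparable M N] {s : Finset F}
    (hsM : ∀ x ∈ s, x ∈ M) (hs : PowIndep p M s) : PowIndep p N.toSubfield s := by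
  classical
  intro a ha h0
  have : ExpChar M p := (algebraMap M F).expChar (algebraMap M F).injective p
  have : ExpChar N p := (algebraMap N F).expChar (algebraMap N F).injective p
  let e := Module.Basis.ofVectorSpace M N
  have he := (e.linearIndependent.map_pow_expChar_pow_of_isSeparable p 1).map'
    N.val.toLinearMap (LinearMap.ker_eq_bot.2 N.val.injective)
  rw [linearIndependent_iff'] at he
  let b : F → Module.Basis.ofVectorSpaceIndex M N →₀ M := fun x ↦
    if hx : x ∈ s then e.repr ⟨a x, ha x hx⟩ else 0
  let J := s.biUnion fun x ↦ (b x).support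
  have hrep : ∀ x ∈ s, a x = ∑ j ∈ J, (b x j : F) * (e j : F) := by
    intro x hx
    have h1 := e.linearCombination_repr ⟨a x, ha x hx⟩
    rw [Finsupp.linearCombination_apply, Finsupp.sum_of_support_subset (s := J) _ _ _ (by simp)]
      at h1
    · have := congr(($h1 : F))
      simp only [b, hx, dif_pos]
      refine (this.symm.trans ?_ :)
      simp [Subfield.smul_def]
    · have : (b x).support ⊆ J := Finset.subset_biUnion_of_mem (fun x ↦ (b x).support) hx
      simpa [b, hx] using this
  have hzero : ∀ j ∈ J, ∑ x ∈ s, (b x j : F) ^ p * x = 0 := by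
    intro j hj
    have hmem : ∀ j, ∑ x ∈ s, (b x j : F) ^ p * x ∈ M := fun j ↦
      sum_mem fun x hx ↦ mul_mem (pow_mem (b x j).2 _) (hsM x hx)
    refine congrArg Subtype.val (he J (fun j ↦ ⟨_, hmem j⟩) ?_ j hj)
    rw [← h0]
    simp only [Subfield.smul_def, smul_eq_mul, Finset.sum_mul]
    rw [Finset.sum_comm]
    refine Finset.sum_congr rfl fun x hx ↦ ?_
    rw [hrep x hx, sum_pow_char, Finset.sum_mul]
    refine Finset.sum_congr rfl fun j _ ↦ ?_
    simp [mul_pow]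
    ring
  intro x hx
  rw [hrep x hx]
  refine Finset.sum_eq_zero fun j hj ↦ ?_
  rw [hs (fun x ↦ (b x j : F)) (fun x _ ↦ (b x j).2) (hzero j hj) x hx, zero_mul]

theorem IntermediateField.toSubfield_adjoin_le {F : Type*} [Field F] {A B : Subfield F} {S : Set F}
    (hA : A ≤ B) (hS : S ⊆ B) : (IntermediateField.adjoin A S).toSubfield ≤ B := by
  rw [IntermediateField.adjoin_toSubfield, Subfield.closure_le]
  refine Set.union_subset ?_ hS
  rintro _ ⟨x, rfl⟩
  exact hA x.2

theorem IsSeparable.ringHom_of_comp_eq {A B E F : Type*} [Field A] [Field B] [Field E] [Field F]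
    [Algebra A E] [Algebra B F] {x : E} (hx : IsSeparable A x) (f : A →+* B) (g : E →+* F)
    (h : (algebraMap B F).comp f = g.comp (algebraMap A E)) : IsSeparable B (g x) := by
  let := f.toAlgebra
  let := g.toAlgebra
  let := (g.comp (algebraMap A E)).toAlgebra
  have : IsScalarTower A E F := .of_algebraMap_eq fun _ ↦ rfl
  have : IsScalarTower A B F := .of_algebraMap_eq fun y ↦ congr($h y).symm
  exact (hx.map (IsScalarTower.toAlgHom A E F) g.injective).tower_top B

theorem SepExt.exists_algebraicIndependent_isSeparable {F : Type*} [Field F] {p : ℕ}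
    (hp : p.Prime) [ExpChar F p] {k L : Subfield F} (h : SepExt p k L) (hkL : k ≤ L)
    (T : Finset F) (hT : (T : Set F) ⊆ L) :
    ∃ t : Set F, t ⊆ L ∧ AlgebraicIndependent k ((↑) : t → F) ∧
      ∀ x ∈ T, IsSeparable (IntermediateField.adjoin k t) x := by
  classical
  let E := IntermediateField.adjoin k (T : Set F)
  have hEL : ∀ x : E, (x : F) ∈ L := fun x ↦ IntermediateField.toSubfield_adjoin_le hkL hT x.2
  have : Algebra.EssFiniteType k E :=
    IntermediateField.essFiniteType_iff.2 (IntermediateField.fg_adjoin_finset T)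
  have : ExpChar E p := (algebraMap E F).expChar (algebraMap E F).injective p
  have : ExpChar k p := (algebraMap k F).expChar (algebraMap k F).injective p
  have hpow (s : Finset E) (hs : LinearIndepOn k id (s : Set E)) :
      LinearIndepOn k (· ^ p) (s : Set E) := by
    have hs' : LinearIndepOn k id ((s.image (algebraMap E F) : Finset F) : Set F) := by
      rw [Finset.coe_image]
      exact LinearIndepOn.id_image_algebraMap_iff.2 hs
    have := h.linearIndepOn_pow hkL (fun x hx ↦ by
      obtain ⟨y, -, rfl⟩ := Finset.mem_image.1 hx
      exact hEL y) hs'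
    rw [Finset.coe_image] at this
    exact LinearIndependent.of_comp E.val.toLinearMap
      (this.comp_of_image (algebraMap E F).injective.injOn)
  obtain ⟨u, hu, hsep⟩ :=
    exists_isTranscendenceBasis_and_isSeparable_of_linearIndepOn_pow_of_essFiniteType p hp hpow
  refine ⟨E.val '' u, ?_, ?_, fun x hx ↦ ?_⟩
  · rintro _ ⟨x, -, rfl⟩
    exact hEL x
  · exact (hu.1.map' (f := E.val) E.val.injective).image
  · have hxE : x ∈ E := IntermediateField.subset_adjoin _ _ hx
    have hxs : IsSeparable (IntermediateField.adjoin k (u : Set E)) (⟨x, hxE⟩ : E) :=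
      Algebra.IsSeparable.isSeparable _ _
    refine hxs.ringHom_of_comp_eq
      (((algebraMap E F).comp (algebraMap (IntermediateField.adjoin k (u : Set E)) E)).codRestrict
        (IntermediateField.adjoin k (E.val '' u)) fun y ↦ ?_) (algebraMap E F) rfl
    exact (IntermediateField.adjoin_map k (u : Set E) E.val).le ⟨y, y.2, rfl⟩

/-- If `k ⊆ K` and `k ⊆ L` are separable and `K` is algebraically independent from `L`
over `k`, then the extension `K ⊆ KL` of `K` by the compositum is separable. -/
theorem sepExt_compositum_of_algIndepFrom
    {p : ℕ} (hp : p.Prime) {F : Type*} [Field F] [CharP F p]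
    (k K L : Subfield F) (hkK : k ≤ K) (hkL : k ≤ L)
    (hsK : SepExt p k K) (hsL : SepExt p k L) (hfree : AlgIndepFrom k K L) :
    SepExt p K (K ⊔ L) := by
  classical
  have : ExpChar F p := .prime hp
  refine sepExt_iff.2 fun s hs_le hs a ha h0 ↦ ?_
  have hKL : K ⊔ L ≤ (IntermediateField.adjoin K (L : Set F)).toSubfield :=
    sup_le (fun x hx ↦ (IntermediateField.adjoin K (L : Set F)).algebraMap_mem ⟨x, hx⟩)
      (IntermediateField.subset_adjoin K (L : Set F))
  have hfin : ∀ x ∈ s, ∃ T : Finset F, (T : Set F) ⊆ L ∧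
      a x ∈ IntermediateField.adjoin K (T : Set F) :=
    fun x hx ↦ IntermediateField.exists_finset_of_mem_adjoin (hKL (ha x hx))
  choose! T hTL haT using hfin
  obtain ⟨t, htL, ht, hsep⟩ := hsL.exists_algebraicIndependent_isSeparable hp hkL (s.biUnion T)
    (by simpa using hTL)
  have htK := hfree.algebraicIndependent hkK hkL (fun i : t ↦ htL i.2) ht
  have hM := PowIndep.adjoin_of_algebraicIndependent hs_le hs htK
  rw [Subtype.range_coe] at hM
  let M := (IntermediateField.adjoin K t).toSubfield
  have hKM : K ≤ M := fun x hx ↦ (IntermediateField.adjoin K t).algebraMap_mem ⟨x, hx⟩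
  have hDM : (IntermediateField.adjoin k t).toSubfield ≤ M :=
    IntermediateField.toSubfield_adjoin_le (hkK.trans hKM) (IntermediateField.subset_adjoin K t)
  let N := IntermediateField.adjoin M (s.biUnion T : Set F)
  have : Algebra.IsSeparable M N := by
    rw [IntermediateField.isSeparable_adjoin_iff_isSeparable]
    intro x hx
    exact (hsep x hx).ringHom_of_comp_eq (Subfield.inclusion hDM) (RingHom.id F) rfl
  refine hM.of_isSeparable N (fun x hx ↦ hKM (hs_le hx)) a (fun x hx ↦ ?_) h0
  exact IntermediateField.toSubfield_adjoin_le (B := N.toSubfield)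
    (fun y hy ↦ N.algebraMap_mem ⟨y, hKM hy⟩)
    (fun y hy ↦ IntermediateField.subset_adjoin _ _ (Finset.mem_biUnion.2 ⟨x, hx, hy⟩)) (haT x hx)
end

section
/- Let p be a prime, let U be a field of characteristic p, and let k ⊆ K and k ⊆ L be subfields of U such that the extensions k ⊆ K, k ⊆ L, K ⊆ U and L ⊆ U are all separable. If K is p-independent from L over k in U (i.e., every subset of K that is p-independent in U over k remains p-independent in U over L), then the extension KL ⊆ U of the compositum is separable. -/
universe u

namespace LinDisjOver

open Module

variable {F : Type u} [Field F] {A E E' V W : Subfield F}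

theorem linearIndependent (h : LinDisjOver A E V) {ι : Type*} {v : ι → F}
    (hvE : ∀ i, v i ∈ E) (hv : LinearIndependent A v) : LinearIndependent V v :=
  (linearIndepOn_id_range_iff hv.injective).1
    (h _ (Set.range_subset_iff.2 hvE) hv.linearIndepOn_id)

theorem of_finite (h : ∀ t : Set F, t.Finite → t ⊆ E →
    ∃ E' : Subfield F, t ⊆ E' ∧ LinDisjOver A E' V) : LinDisjOver A E V := by
  intro S hS hSA
  have hSA' : LinearIndepOn A id S := hSA
  refine linearIndepOn_of_finite (R := V) (v := id) S fun t htS ht => ?_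
  obtain ⟨E', htE', hE'⟩ := h t ht (htS.trans hS)
  exact hE' t htE' (hSA'.mono htS)

/-- A spanning family of `E` over `A` that is linearly independent over `V ⊇ A` witnesses
linear disjointness. -/
theorem of_span (hAE : A ≤ E) (hAV : A ≤ V) {ι : Type*} {v : ι → F} (hvE : ∀ i, v i ∈ E)
    (hspan : ∀ x ∈ E, x ∈ Submodule.span A (Set.range v)) (hv : LinearIndependent V v) :
    LinDisjOver A E V := by
  intro S hS hSA
  let : Algebra A V := (Subfield.inclusion hAV).toAlgebra
  have : IsScalarTower A V F := .of_algebraMap_eq fun _ => rfl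
  let B : IntermediateField A F := Subfield.extendScalars hAE
  let w : ι → B := fun i => ⟨v i, hvE i⟩
  have hw : LinearIndependent A w :=
    LinearIndependent.of_comp B.val.toLinearMap (hv.restrict_scalars' A)
  have hspan' : ⊤ ≤ Submodule.span A (Set.range w) := by
    rintro ⟨x, hx⟩ -
    have hx' := hspan x hx
    rw [show Set.range v = B.val.toLinearMap '' Set.range w by rw [← Set.range_comp]; rfl,
      Submodule.span_image] at hx'
    obtain ⟨y, hy, hyx⟩ := hx'
    obtain rfl : y = ⟨x, hx⟩ := Subtype.ext hyx
    exact hy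
  have hd : B.LinearDisjoint V := .of_basis_left (Basis.mk hw hspan') (by
    rw [Basis.coe_mk]
    exact hv)
  exact hd.linearIndependent_left (a := fun s : S => (⟨s, hS s.2⟩ : B))
    (LinearIndependent.of_comp B.val.toLinearMap hSA)

/-- A family in `E` that is a basis of `E` over `A`. -/
theorem _root_.Subfield.exists_basis_family (A E : Subfield F) : ∃ (ι : Type u) (b : ι → F), (∀ i, b i ∈ E) ∧
    LinearIndependent A b ∧ ∀ x ∈ E, x ∈ Submodule.span A (Set.range b) := by
  obtain ⟨b, hbE, hspan, hb⟩ := exists_linearIndependent A (E : Set F)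
  refine ⟨b, Subtype.val, fun i => hbE i.2, hb, fun x hx => ?_⟩
  rw [Subtype.range_coe, hspan]
  exact Submodule.subset_span hx

theorem trans (hAE : A ≤ E) (hEE' : E ≤ E') (hAV : A ≤ V) (hEW : E ≤ W) (hVW : V ≤ W)
    (h : LinDisjOver A E V) (h' : LinDisjOver E E' W) : LinDisjOver A E' V := by
  obtain ⟨ι, b, hbE, hb, hbspan⟩ := Subfield.exists_basis_family A E
  obtain ⟨κ, c, hcE, hc, hcspan⟩ := Subfield.exists_basis_family E E'
  replace hb := h.linearIndependent hbE hb
  replace hc := h'.linearIndependent hcE hc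
  let : Algebra V W := (Subfield.inclusion hVW).toAlgebra
  have : IsScalarTower V W F := .of_algebraMap_eq fun _ => rfl
  let b' : ι → W := fun i => ⟨b i, hEW (hbE i)⟩
  have hb' : LinearIndependent V b' :=
    LinearIndependent.of_comp (IsScalarTower.toAlgHom V W F).toLinearMap hb
  have hbc : LinearIndependent V fun q : ι × κ => b q.1 * c q.2 := by
    have hsmul : (fun q : ι × κ => b q.1 * c q.2) = fun q => b' q.1 • c q.2 := rfl
    rw [hsmul]
    exact linearIndependent_smul hb' hc
  refine of_span (v := fun q : ι × κ => b q.1 * c q.2) (hAE.trans hEE') hAV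
    (fun q => mul_mem (hEE' (hbE _)) (hcE _)) (fun x hx => ?_) hbc
  have hmul : ∀ y ∈ E, ∀ j,
      y * c j ∈ Submodule.span A (Set.range fun q : ι × κ => b q.1 * c q.2) := by
    intro y hy j
    obtain ⟨f, rfl⟩ := Finsupp.mem_span_range_iff_exists_finsupp.1 (hbspan y hy)
    rw [Finsupp.sum, Finset.sum_mul]
    refine Submodule.sum_mem _ fun i _ => ?_
    rw [smul_mul_assoc]
    exact Submodule.smul_mem _ _ (Submodule.subset_span ⟨(i, j), rfl⟩)
  obtain ⟨f, rfl⟩ := Finsupp.mem_span_range_iff_exists_finsupp.1 (hcspan x hx)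
  exact Submodule.sum_mem _ fun j _ => hmul _ (f j).2 j

end LinDisjOver

namespace Subfield

variable {F : Type*} [Field F]

theorem mem_span_of_mem_sup {p : ℕ} (hp : p ≠ 0) {V E : Subfield F} (hE : ∀ x ∈ E, x ^ p ∈ V)
    {x : F} (hx : x ∈ V ⊔ E) : x ∈ Submodule.span V (E : Set F) := by
  have hle : V ⊔ E ≤ (IntermediateField.adjoin V (E : Set F)).toSubfield :=
    sup_le (fun y hy => (IntermediateField.adjoin V (E : Set F)).algebraMap_mem ⟨y, hy⟩)
      (fun y hy => IntermediateField.subset_adjoin V _ hy)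
  have hx' := hle hx
  have halg : ∀ y ∈ (E : Set F), IsAlgebraic V y := fun y hy =>
    .of_pow (Nat.pos_of_ne_zero hp) (isAlgebraic_algebraMap (⟨y ^ p, hE y hy⟩ : V))
  have hxa : x ∈ Subalgebra.toSubmodule (Algebra.adjoin V (E : Set F)) := by
    rw [← IntermediateField.adjoin_toSubalgebra_of_isAlgebraic halg]
    exact hx'
  rw [Algebra.adjoin_eq_span] at hxa
  have hcl : (Submonoid.closure (E : Set F) : Set F) = E :=
    congrArg SetLike.coe (Submonoid.closure_eq E.toSubmonoid)
  rwa [hcl] at hxa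

theorem exists_finite_subset_of_mem_sup {K L : Subfield F} {x : F} (hx : x ∈ K ⊔ L) :
    ∃ T : Set F, T ⊆ K ∧ T.Finite ∧ x ∈ L ⊔ closure T := by
  have hle : K ⊔ L ≤ (IntermediateField.adjoin L (K : Set F)).toSubfield :=
    sup_le (fun y hy => IntermediateField.subset_adjoin L _ hy)
      (fun y hy => (IntermediateField.adjoin L (K : Set F)).algebraMap_mem ⟨y, hy⟩)
  obtain ⟨T, hT, hxT⟩ := IntermediateField.exists_finset_of_mem_adjoin (hle hx)
  refine ⟨T, hT, T.finite_toSet, ?_⟩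
  have hle' : (IntermediateField.adjoin L (T : Set F)).toSubfield ≤ L ⊔ closure (T : Set F) := by
    rw [IntermediateField.adjoin_toSubfield, closure_le]
    rintro y (⟨z, rfl⟩ | hy)
    · exact (le_sup_left : L ≤ _) z.2
    · exact (le_sup_right : closure (T : Set F) ≤ _) (subset_closure hy)
  exact hle' hxT

theorem exists_finite_subset_of_subset_sup {K L : Subfield F} {t : Set F} (ht : t.Finite)
    (htKL : t ⊆ (K ⊔ L : Subfield F)) :
    ∃ T : Set F, T ⊆ K ∧ T.Finite ∧ t ⊆ (L ⊔ closure T : Subfield F) := by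
  choose! T hTK hT hxT using fun x (hx : x ∈ t) => exists_finite_subset_of_mem_sup (htKL hx)
  exact ⟨⋃ x ∈ t, T x, Set.iUnion₂_subset hTK, ht.biUnion hT, fun x hx =>
    (sup_le_sup_left (closure_mono (Set.subset_biUnion_of_mem hx)) L :) (hxT x hx)⟩

/-- A finite set contains a minimal subset generating it over a given subfield. -/
theorem exists_minimal_generating_subset (W : Subfield F) {T : Set F} (hT : T.Finite) :
    ∃ C ⊆ T, T ⊆ (W ⊔ closure C : Subfield F) ∧ ∀ c ∈ C, c ∉ W ⊔ closure (C \ {c}) := by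
  have hfin : {C | C ⊆ T ∧ T ⊆ (W ⊔ closure C : Subfield F)}.Finite :=
    hT.finite_subsets.subset fun _ h => h.1
  obtain ⟨C, hC⟩ := hfin.exists_minimal
    ⟨T, subset_rfl, subset_closure.trans (le_sup_right : closure T ≤ W ⊔ closure T)⟩
  refine ⟨C, hC.prop.1, hC.prop.2, fun c hc hcW => ?_⟩
  have hle : W ⊔ closure C ≤ W ⊔ closure (C \ {c}) := by
    refine sup_le le_sup_left (closure_le.2 fun y hy => ?_)
    by_cases h : y = c
    · exact h ▸ hcW
    · exact (le_sup_right : closure (C \ {c}) ≤ _) (subset_closure ⟨hy, h⟩)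
  exact (hC.le_of_le ⟨Set.sdiff_subset.trans hC.prop.1, hC.prop.2.trans hle⟩ Set.sdiff_subset hc).2
    rfl

theorem pow_mem_pPow (p : ℕ) {K : Subfield F} {x : F} (hx : x ∈ K) : x ^ p ∈ K.pPow p :=
  subset_closure ⟨x, hx, rfl⟩

theorem pPow_mono (p : ℕ) {K L : Subfield F} (h : K ≤ L) : K.pPow p ≤ L.pPow p :=
  closure_mono (Set.image_mono h)

theorem pPow_le (p : ℕ) (K : Subfield F) : K.pPow p ≤ K := by
  rw [pPow, closure_le]
  rintro _ ⟨x, hx, rfl⟩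
  exact pow_mem hx p

end Subfield

theorem pIndepOver_iff {F : Type*} [Field F] {p : ℕ} {k M : Subfield F} {S : Set F} :
    PIndepOver p k M S ↔ ∀ s ∈ S, s ∉ M.pPow p ⊔ k ⊔ Subfield.closure (S \ {s}) := by
  simp only [PIndepOver, Subfield.closure_union, Subfield.closure_eq, Subfield.pPow]

namespace LinDisjOver

variable {F : Type*} [Field F] {p : ℕ} {A A' E V W : Subfield F}

theorem sup_of_pow_mem (hp : p ≠ 0) (hAA' : A ≤ A') (hA'V : A' ≤ V)
    (hE : ∀ x ∈ E, x ^ p ∈ A) (h : LinDisjOver A E V) : LinDisjOver A' (A' ⊔ E) V := by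
  obtain ⟨ι, b, hbE, hb, hbspan⟩ := Subfield.exists_basis_family A E
  refine of_span le_sup_left hA'V (fun i => (le_sup_right : E ≤ _) (hbE i)) (fun x hx => ?_)
    (h.linearIndependent hbE hb)
  refine Submodule.span_le.2 (fun y hy => ?_)
    (Subfield.mem_span_of_mem_sup hp (fun x hx => hAA' (hE x hx)) hx)
  obtain ⟨f, rfl⟩ := Finsupp.mem_span_range_iff_exists_finsupp.1 (hbspan y hy)
  exact Submodule.sum_mem _ fun j _ =>
    Submodule.smul_mem _ (⟨f j, hAA' (f j).2⟩ : A') (Submodule.subset_span ⟨j, rfl⟩)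

theorem mem_of_mem_sup {K : Subfield F} (hp : p ≠ 0) (hAE : A ≤ E) (hEK : E ≤ K) (hAV : A ≤ V)
    (hE : ∀ x ∈ E, x ^ p ∈ V) (h : LinDisjOver A K V) {x : F} (hxK : x ∈ K) (hx : x ∈ V ⊔ E) :
    x ∈ E := by
  by_contra hxE
  obtain ⟨b, hbE, hspan, hb⟩ := exists_linearIndependent A (E : Set F)
  have hsub : Submodule.span A b ≤
      (IntermediateField.toSubalgebra (Subfield.extendScalars hAE)).toSubmodule :=
    Submodule.span_le.2 hbE
  have hxb : x ∉ b := fun h => hxE (hbE h)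
  have hins : LinearIndepOn A id (insert x b) :=
    LinearIndepOn.insert hb (by simpa using fun h => hxE (hsub h))
  have hV : LinearIndepOn V id (insert x b) :=
    h _ (Set.insert_subset hxK (hbE.trans hEK)) hins
  refine ((linearIndepOn_insert hxb).1 hV).2 ?_
  rw [Set.image_id]
  refine Submodule.span_le.2 (fun y hy => ?_) (Subfield.mem_span_of_mem_sup hp hE hx)
  have hyb : y ∈ Submodule.span A b := hspan ▸ Submodule.subset_span hy
  refine Submodule.span_induction (fun z hz => Submodule.subset_span hz) (zero_mem _)
    (fun _ _ _ _ h h' => add_mem h h') (fun a z _ hz => ?_) hyb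
  exact Submodule.smul_mem _ (⟨a, hAV a.2⟩ : V) hz

end LinDisjOver

theorem minpoly_eq_X_pow_sub_C_of_notMem {F : Type*} [Field F] {p : ℕ} (hp : p.Prime) [CharP F p]
    {E : Subfield F} {c : F} (hc : c ^ p ∈ E) (hcE : c ∉ E) :
    minpoly E c = Polynomial.X ^ p - Polynomial.C ⟨c ^ p, hc⟩ := by
  have : Fact p.Prime := ⟨hp⟩
  refine (minpoly.eq_of_irreducible_of_monic
    (X_pow_sub_C_irreducible_of_prime hp fun b hb => hcE ?_) ?_
    (Polynomial.monic_X_pow_sub_C _ hp.ne_zero)).symm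
  · have : (b : F) = c := frobenius_inj F p (congrArg Subtype.val hb)
    exact this ▸ b.2
  · simp only [map_sub, map_pow, Polynomial.aeval_X, Polynomial.aeval_C]
    exact sub_self _

namespace LinDisjOver

variable {F : Type*} [Field F] {p : ℕ} {A A' E V W : Subfield F}

theorem sup_closure_singleton (hp : p.Prime) [CharP F p] (hEW : E ≤ W) {c : F} (hc : c ^ p ∈ E)
    (hcW : c ∉ W) : LinDisjOver E (E ⊔ Subfield.closure {c}) W := by
  have hdeg : ∀ {M : Subfield F}, c ^ p ∈ M → c ∉ M → (minpoly M c).natDegree = p := by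
    intro M h h'
    rw [minpoly_eq_X_pow_sub_C_of_notMem hp h h', Polynomial.natDegree_X_pow_sub_C]
  have hind : LinearIndependent W fun i : Fin p => c ^ (i : ℕ) := by
    have := linearIndependent_pow (K := W) c
    rwa [hdeg (hEW hc) hcW] at this
  have hcE : c ∈ E ⊔ Subfield.closure {c} :=
    (le_sup_right : Subfield.closure {c} ≤ _) (Subfield.subset_closure rfl)
  refine of_span le_sup_left hEW (fun i => pow_mem hcE _) (fun x hx => ?_) hind
  have hint : IsIntegral E c := .of_pow hp.pos (isIntegral_algebraMap (x := (⟨c ^ p, hc⟩ : E)))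
  have hle : E ⊔ Subfield.closure {c} ≤ (IntermediateField.adjoin E {c}).toSubfield :=
    sup_le (fun y hy => (IntermediateField.adjoin E {c}).algebraMap_mem ⟨y, hy⟩)
      (Subfield.closure_le.2 (IntermediateField.subset_adjoin E _))
  have hxa : x ∈ (IntermediateField.adjoin E {c}).toSubalgebra := hle hx
  rw [IntermediateField.adjoin_simple_toSubalgebra_of_isAlgebraic hint.isAlgebraic,
    Algebra.adjoin_singleton_eq_range_aeval] at hxa
  obtain ⟨f, rfl⟩ := hxa
  have := hint.mem_span_pow (y := Polynomial.aeval c f) ⟨f, rfl⟩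
  rwa [hdeg hc fun h => hcW (hEW h)] at this

theorem sup_closure (hp : p.Prime) [CharP F p] (hAE : A ≤ E) (hAV : A ≤ V) (hEW : E ≤ W)
    (hVW : V ≤ W) (h : LinDisjOver A E V) {C : Set F} (hC : C.Finite) (hCA : ∀ c ∈ C, c ^ p ∈ A)
    (hind : ∀ c ∈ C, c ∉ W ⊔ Subfield.closure (C \ {c})) :
    LinDisjOver A (E ⊔ Subfield.closure C) V := by
  induction C, hC using Set.Finite.induction_on with
  | empty => simpa using h
  | @insert c C hcC _ ih =>
    have hsup : E ⊔ Subfield.closure (insert c C) =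
        E ⊔ Subfield.closure C ⊔ Subfield.closure {c} := by
      rw [Set.insert_eq, Subfield.closure_union, sup_assoc, sup_comm (Subfield.closure {c})]
    rw [hsup]
    have hcW := hind c (Set.mem_insert c C)
    rw [Set.insert_sdiff_self_of_notMem hcC] at hcW
    refine trans (W := W ⊔ Subfield.closure C) (hAE.trans le_sup_left) le_sup_left hAV
      (sup_le_sup_right hEW _) (hVW.trans le_sup_left)
      (ih (fun d hd => hCA d (Set.mem_insert_of_mem c hd)) fun d hd hdW => ?_)
      (sup_closure_singleton hp (sup_le_sup_right hEW _)
        ((hAE.trans le_sup_left) (hCA c (Set.mem_insert c C))) hcW)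
    exact hind d (Set.mem_insert_of_mem c hd) ((sup_le_sup_left (Subfield.closure_mono
      (Set.sdiff_subset_sdiff_left (Set.subset_insert c C))) W :) hdW)

end LinDisjOver

/-- If `k ⊆ K`, `k ⊆ L`, `K ⊆ U` and `L ⊆ U` are separable (with `U` the ambient field)
and `K` is `p`-independent from `L` over `k` in `U`, then the extension `KL ⊆ U` of the
compositum is separable. -/
theorem sepExt_compositum_ambient_of_pIndepFrom
    {p : ℕ} (hp : p.Prime) {U : Type*} [Field U] [CharP U p]
    (k K L : Subfield U) (hkK : k ≤ K) (hkL : k ≤ L)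
    (hsK : SepExt p k K) (hsL : SepExt p k L)
    (hsKU : SepExt p K ⊤) (hsLU : SepExt p L ⊤)
    (hpind : ∀ S : Set U, S ⊆ (K : Set U) →
      PIndepOver p k ⊤ S → PIndepOver p L ⊤ S) :
    SepExt p (K ⊔ L) ⊤ := by
  have hV : ∀ x : U, x ^ p ∈ (⊤ : Subfield U).pPow p := fun x => Subfield.pow_mem_pPow p trivial
  have hpow : ∀ N : Subfield U, N.pPow p ≤ (⊤ : Subfield U).pPow p :=
    fun N => Subfield.pPow_mono p le_top
  unfold SepExt at hsKU hsLU ⊢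
  generalize hM : K ⊔ L = M
  have hKM : K ≤ M := hM ▸ le_sup_left
  have hLM : L ≤ M := hM ▸ le_sup_right
  have hpind' : ∀ C ⊆ (K : Set U),
      (∀ c ∈ C, c ∉ (⊤ : Subfield U).pPow p ⊔ k ⊔ Subfield.closure (C \ {c})) →
      ∀ c ∈ C, c ∉ (⊤ : Subfield U).pPow p ⊔ L ⊔ Subfield.closure (C \ {c}) :=
    fun C hC h => pIndepOver_iff.1 (hpind C hC (pIndepOver_iff.2 h))
  generalize (⊤ : Subfield U).pPow p = V at hV hpow hsKU hsLU hpind' ⊢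
  refine LinDisjOver.of_finite fun t ht htM => ?_
  obtain ⟨T, hTK, hT, htT⟩ := Subfield.exists_finite_subset_of_subset_sup ht (hM ▸ htM)
  obtain ⟨C, hCT, hTC, hC⟩ := Subfield.exists_minimal_generating_subset (V ⊔ k) hT
  have hCK : C ⊆ K := hCT.trans hTK
  have hTE : T ⊆ (K.pPow p ⊔ (k ⊔ Subfield.closure C) : Subfield U) := by
    intro x hx
    have hxV : x ∈ V ⊔ (K.pPow p ⊔ (k ⊔ Subfield.closure C)) := by
      refine (?_ : V ⊔ k ⊔ Subfield.closure C ≤ _) (hTC hx)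
      rw [sup_assoc]
      exact sup_le_sup_left le_sup_right V
    exact hsKU.mem_of_mem_sup hp.ne_zero le_sup_left
      (sup_le (Subfield.pPow_le p K) (sup_le hkK (Subfield.closure_le.2 hCK))) (hpow K)
      (fun y _ => hV y) (hTK hx) hxV
  refine ⟨M.pPow p ⊔ L ⊔ Subfield.closure C, htT.trans ?_, ?_⟩
  · exact sup_le (le_sup_right.trans le_sup_left) ((Subfield.closure_le.2 hTE).trans
      (sup_le ((Subfield.pPow_mono p hKM).trans (le_sup_left.trans le_sup_left))
        (sup_le_sup_right (hkL.trans le_sup_right) _)))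
  · have hL : LinDisjOver (M.pPow p) (M.pPow p ⊔ L) V :=
      hsLU.sup_of_pow_mem hp.ne_zero (Subfield.pPow_mono p hLM) (hpow M)
        fun x hx => Subfield.pow_mem_pPow p hx
    exact hL.sup_closure hp le_sup_left (hpow M) (sup_le_sup_right (hpow M) L) le_sup_left
      (hT.subset hCT) (fun c hc => Subfield.pow_mem_pPow p (hKM (hCK hc))) (hpind' C hCK hC)
end

section
/- Let p be a prime, let U be a field of characteristic p with a derivation ∂, and let a₁, …, a_n ∈ U and k₁, …, k_n ≥ 1 be such that ∂(a_i) = a_i^{p^{k_i}+1} for each i. Let w(X₁, …, X_n) = X₁^{α₁}⋯X_n^{α_n} be a monomial with 0 ≤ α_i ≤ p−1 for all i. Then ∂(w(a₁, …, a_n)) = (∑_{i=1}^n α_i · a_i^{p^{k_i−1}})^p · w(a₁, …, a_n), where each α_i is read as an element of the prime field F_p ⊆ U. -/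
/-- Logarithmic derivatives of products add up. -/
theorem Derivation.map_prod_of_eq_mul {R A ι : Type*} [CommSemiring R] [CommSemiring A]
    [Algebra R A] (d : Derivation R A A) (s : Finset ι) (x c : ι → A)
    (h : ∀ i ∈ s, d (x i) = c i * x i) :
    d (∏ i ∈ s, x i) = (∑ i ∈ s, c i) * ∏ i ∈ s, x i := by
  classical
  induction s using Finset.induction_on with
  | empty => simp
  | insert j s hj ih =>
    rw [Finset.prod_insert hj, Finset.sum_insert hj, Derivation.leibniz, h j (by simp),
      ih fun i hi => h i (Finset.mem_insert_of_mem hi), smul_eq_mul, smul_eq_mul]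
    ring

/-- The logarithmic derivative of a power is a multiple of that of the base. -/
theorem Derivation.map_pow_of_eq_mul {R A : Type*} [CommSemiring R] [CommSemiring A]
    [Algebra R A] (d : Derivation R A A) {x c : A} (h : d x = c * x) (m : ℕ) :
    d (x ^ m) = m * c * x ^ m := by
  simpa using d.map_prod_of_eq_mul (Finset.range m) (fun _ => x) (fun _ => c) fun _ _ => h

/-- Let `U` be a field of characteristic `p` with a derivation `d`, and suppose
`d(aᵢ) = aᵢ^(p^(kᵢ)+1)` with `kᵢ ≥ 1` for each `i`. Then for a `p`-monomial
`w = a₁^α₁ ⋯ a_n^α_n` with `0 ≤ αᵢ ≤ p − 1`, we have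
`d(w) = (∑ i, αᵢ · aᵢ^(p^(kᵢ−1)))^p · w`, where each `αᵢ` is read as an element of the
prime field `F_p ⊆ U` (via the natural map `ℕ → U`). -/
theorem derivation_p_monomial
    {p : ℕ} (hp : p.Prime) {U : Type*} [Field U] [CharP U p]
    (d : Derivation ℤ U U) {n : ℕ} (a : Fin n → U) (k : Fin n → ℕ)
    (hk : ∀ i, 1 ≤ k i) (hd : ∀ i, d (a i) = a i ^ (p ^ k i + 1))
    (α : Fin n → ℕ) (hα : ∀ i, α i ≤ p - 1) :
    d (∏ i, a i ^ α i)
      = (∑ i, (α i : U) * a i ^ p ^ (k i - 1)) ^ p * ∏ i, a i ^ α i := by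
  have : Fact p.Prime := ⟨hp⟩
  rw [d.map_prod_of_eq_mul Finset.univ _ (fun i => (α i : U) * a i ^ p ^ k i)
    fun i _ => d.map_pow_of_eq_mul (by rw [hd i, pow_succ]) (α i), sum_pow_char p]
  congr 1
  refine Finset.sum_congr rfl fun i _ => ?_
  rw [mul_pow, ← pow_mul, ← pow_succ, Nat.sub_add_cancel (hk i),
    ← frobenius_def p (α i : U), map_natCast]
end

section
/- Let p be a prime, let U be a field of characteristic p with a derivation ∂, and let a₁, …, a_n ∈ U be pairwise distinct nonzero elements such that ∂(a_i) = a_i^{p^{k_i}+1} for some integers k_i ≥ 1 (1 ≤ i ≤ n). Then the elements 1, a₁, …, a_n are linearly independent over the subfield U^p of p-th powers of U. -/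
theorem Derivation.map_pow_char_eq_zero {p : ℕ} {U : Type*} [Field U] [CharP U p]
    (d : Derivation ℤ U U) (x : U) : d (x ^ p) = 0 := by
  rw [Derivation.leibniz_pow, nsmul_eq_mul, CharP.cast_eq_zero, zero_mul]

theorem Derivation.map_eq_zero_of_mem_closure_pow_char {p : ℕ} {U : Type*} [Field U] [CharP U p]
    (d : Derivation ℤ U U) {c : U}
    (hc : c ∈ Subfield.closure ((fun x : U => x ^ p) '' Set.univ)) : d c = 0 := by
  induction hc using Subfield.closure_induction with
  | mem x hx =>
    obtain ⟨y, -, rfl⟩ := hx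
    exact d.map_pow_char_eq_zero y
  | one => exact d.map_one_eq_zero
  | add x y _ _ hx hy => rw [map_add, hx, hy, add_zero]
  | neg x _ hx => rw [map_neg, hx, neg_zero]
  | inv x _ hx => rw [Derivation.leibniz_inv, hx, smul_zero]
  | mul x y _ _ hx hy => rw [Derivation.leibniz, hx, hy, smul_zero, smul_zero, add_zero]

/-- A derivation in characteristic `p`, as a linear endomorphism over the field of `p`-th powers. -/
def Derivation.linearOverPPowers (p : ℕ) {U : Type*} [Field U] [CharP U p]
    (d : Derivation ℤ U U) :
    Module.End (Subfield.closure ((fun x : U => x ^ p) '' Set.univ)) U where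
  toFun := d
  map_add' := map_add d
  map_smul' c x := by
    simp [Subfield.smul_def, d.map_eq_zero_of_mem_closure_pow_char c.2]

/-- Nonzero solutions of `d x = x ^ (p ^ m + 1)` are determined by `x ^ p ^ m`, even when the
exponents `m` differ. -/
theorem Derivation.eq_of_pow_eq_pow {p : ℕ} (hp : p.Prime) {U : Type*} [Field U] [CharP U p]
    (d : Derivation ℤ U U) {x y : U} {k l : ℕ} (hx : x ≠ 0)
    (hdx : d x = x ^ (p ^ k + 1)) (hkl : k ≤ l) (h : x ^ p ^ k = y ^ p ^ l) : x = y := by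
  have : Fact p.Prime := ⟨hp⟩
  obtain ⟨m, rfl⟩ := Nat.exists_eq_add_of_le hkl
  have hxy : x = y ^ p ^ m := by
    apply iterateFrobenius_inj U p k
    simp only [iterateFrobenius_def]
    rw [h, ← pow_mul, pow_add, mul_comm]
  cases m with
  | zero => simpa using hxy
  | succ m =>
    have h0 : d x = 0 := by
      rw [hxy, pow_succ, pow_mul]
      exact d.map_pow_char_eq_zero _
    exact absurd (hdx.symm.trans h0) (pow_ne_zero _ hx)

/-- Let `U` be a field of characteristic `p` with a derivation `d`, and let
`a₁, …, a_n` be pairwise distinct nonzero elements with `d(aᵢ) = aᵢ^(p^(kᵢ)+1)` for some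
`kᵢ ≥ 1`. Then `1, a₁, …, a_n` are linearly independent over the subfield `U^p`. -/
theorem one_and_solutions_linearIndependent_over_pPowers
    {p : ℕ} (hp : p.Prime) {U : Type*} [Field U] [CharP U p]
    (d : Derivation ℤ U U) {n : ℕ} (a : Fin n → U)
    (hinj : Function.Injective a) (hne : ∀ i, a i ≠ 0)
    (k : Fin n → ℕ) (hk : ∀ i, 1 ≤ k i)
    (hd : ∀ i, d (a i) = a i ^ (p ^ k i + 1)) :
    LinearIndependent (Subfield.closure ((fun x : U => x ^ p) '' Set.univ))
      (Fin.cons (1 : U) a : Fin (n + 1) → U) := by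
  have hmem (i : Fin n) :
      a i ^ p ^ k i ∈ Subfield.closure ((fun x : U => x ^ p) '' Set.univ) := by
    refine Subfield.subset_closure ⟨a i ^ p ^ (k i - 1), Set.mem_univ _, ?_⟩
    change (a i ^ p ^ (k i - 1)) ^ p = _
    rw [← pow_mul, ← pow_succ, Nat.sub_add_cancel (hk i)]
  refine Module.End.eigenvectors_linearIndependent' (d.linearOverPPowers p)
    (Fin.cons 0 fun i => ⟨a i ^ p ^ k i, hmem i⟩) ?_ _ ?_
  · refine Fin.cons_injective_iff.2 ⟨?_, fun i j hij => hinj ?_⟩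
    · rintro ⟨i, hi⟩
      exact pow_ne_zero _ (hne i) (congrArg Subtype.val hi)
    · have h : a i ^ p ^ k i = a j ^ p ^ k j := congrArg Subtype.val hij
      rcases le_total (k i) (k j) with hle | hle
      · exact d.eq_of_pow_eq_pow hp (hne i) (hd i) hle h
      · exact (d.eq_of_pow_eq_pow hp (hne j) (hd j) hle h.symm).symm
  · refine Fin.cases ?_ fun i => ?_
    · refine Module.End.hasEigenvector_iff.2 ⟨Module.End.mem_eigenspace_iff.2 ?_, one_ne_zero⟩
      simp [Derivation.linearOverPPowers]
    · refine Module.End.hasEigenvector_iff.2 ⟨Module.End.mem_eigenspace_iff.2 ?_, hne i⟩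
      change d (a i) = a i ^ p ^ k i * a i
      rw [hd, pow_succ]
end

section
/- Let p be a prime, let U be a field of characteristic p with a derivation ∂, and let a₁, …, a_n ∈ U be pairwise distinct nonzero elements such that ∂(a_i) = a_i^{p^{k_i}+1} for some integers k_i ≥ 1 (1 ≤ i ≤ n). Then the set {a₁, …, a_n} is p-independent in U over the prime field F_p; that is, for each i, a_i does not lie in the subfield U^p · F_p(a₁, …, a_{i−1}, a_{i+1}, …, a_n). -/
/-- A derivation in characteristic `p`, as a linear endomorphism over the subfield of
`p`-th powers. -/
def Derivation.toEndFrobeniusFieldRange {p : ℕ} [Fact p.Prime] {U : Type*} [Field U] [CharP U p]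
    (d : Derivation ℤ U U) : Module.End (frobenius U p).fieldRange U where
  toFun := d
  map_add' := map_add d
  map_smul' := by
    rintro ⟨_, c, rfl⟩ x
    simp [Subfield.smul_def, frobenius_def, d.leibniz_pow]

/-- An eigenvector of a derivation whose eigenvalue is a `p`-th power is not a combination, over the
subfield of `p`-th powers, of eigenvectors with other such eigenvalues. -/
theorem Derivation.eq_zero_of_mem_span_eigenvectors {p : ℕ} [Fact p.Prime] {U : Type*} [Field U]
    [CharP U p] (d : Derivation ℤ U U) {x l : U} (hx : d x = l ^ p * x)
    (hmem : x ∈ Submodule.span (frobenius U p).fieldRange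
      {y : U | ∃ c : U, c ≠ l ∧ d y = c ^ p * y}) : x = 0 := by
  let T : Module.End (frobenius U p).fieldRange U := d.toEndFrobeniusFieldRange
  let φ : U → (frobenius U p).fieldRange := fun c => ⟨frobenius U p c, c, rfl⟩
  have hφ {c y : U} (h : d y = c ^ p * y) : y ∈ T.eigenspace (φ c) :=
    Module.End.mem_eigenspace_iff.2 h
  refine Submodule.disjoint_def.1 (T.eigenspaces_iSupIndep (φ l)) x (hφ hx)
    (Submodule.span_le.2 ?_ hmem)
  rintro y ⟨c, hc, hy⟩
  have hne : φ c ≠ φ l := fun h => hc (frobenius_inj U p (congrArg Subtype.val h))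
  exact Submodule.mem_iSup_of_mem (φ c) (Submodule.mem_iSup_of_mem hne (hφ hy))

/-- Distinct nonzero solutions `aᵢ` of `d aᵢ = aᵢ ^ (p ^ (mᵢ + 1) + 1)` have powers `aᵢ ^ p ^ mᵢ`
that satisfy no nontrivial linear relation over the prime field. -/
theorem Derivation.intCast_eq_zero_of_sum_mul_pow_eq_zero {p : ℕ} [Fact p.Prime] {U : Type*}
    [Field U] [CharP U p] (d : Derivation ℤ U U) {ι : Type*} [Fintype ι] {a : ι → U}
    (hinj : Function.Injective a) (hne : ∀ i, a i ≠ 0) {m : ι → ℕ}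
    (hd : ∀ i, d (a i) = (a i ^ p ^ m i) ^ p * a i) {e : ι → ℤ}
    (he : ∑ i, (e i : U) * a i ^ p ^ m i = 0) (i : ι) : (e i : U) = 0 := by
  classical
  suffices h : ∀ t, (∀ i, m i < t → (e i : U) = 0) ∧ ∑ i, (e i : U) * a i ^ p ^ (m i - t) = 0 from
    (h (m i + 1)).1 i (Nat.lt_succ_self _)
  intro t
  induction t with
  | zero => exact ⟨fun i h => absurd h (Nat.not_lt_zero _), by simpa using he⟩
  | succ t ih =>
    obtain ⟨hlt, hsum⟩ := ih
    have heq : ∀ i, m i = t → (e i : U) = 0 := by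
      intro i hi
      have hx : d ((e i : U) * a i) = (a i ^ p ^ t) ^ p * ((e i : U) * a i) := by
        simp [hd, hi]
        ring
      refine (mul_eq_zero.1 (d.eq_zero_of_mem_span_eigenvectors hx ?_)).resolve_right (hne i)
      rw [← Finset.add_sum_erase _ _ (Finset.mem_univ i), hi, Nat.sub_self, pow_zero, pow_one,
        add_eq_zero_iff_eq_neg] at hsum
      rw [hsum]
      refine Submodule.neg_mem _ (Submodule.sum_mem _ fun j hj => ?_)
      rcases lt_trichotomy (m j) t with h | h | h
      · simp [hlt j h]
      · refine Submodule.subset_span ⟨a j ^ p ^ t, fun hc => Finset.ne_of_mem_erase hj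
          (hinj (iterateFrobenius_inj U p t ?_)), ?_⟩
        · simpa [iterateFrobenius_def] using hc
        · simp [hd, h]
          ring
      · refine Submodule.subset_span ⟨0, (pow_ne_zero _ (hne i)).symm, ?_⟩
        have hp0 : ((p ^ (m j - t) : ℕ) : U) = 0 := by
          simp [Nat.sub_ne_zero_of_lt h]
        have : p ≠ 0 := (Fact.out : p.Prime).ne_zero
        rw [d.leibniz, d.leibniz_pow, ← Nat.cast_smul_eq_nsmul U, hp0]
        simp [this]
    have hle : ∀ i, m i < t + 1 → (e i : U) = 0 := fun i hi =>
      (Nat.lt_succ_iff_lt_or_eq.1 hi).elim (hlt i) (heq i)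
    refine ⟨hle, frobenius_inj U p ?_⟩
    rw [map_zero, map_sum, ← hsum]
    refine Finset.sum_congr rfl fun j _ => ?_
    by_cases h : m j < t + 1
    · simp [hle j h]
    · rw [map_mul, _root_.map_intCast, frobenius_def, ← pow_mul, ← pow_succ,
        show m j - (t + 1) + 1 = m j - t by omega]

/-- Let `U` be a field of characteristic `p` with a derivation `d`, and let
`a₁, …, a_n` be pairwise distinct nonzero elements with `d(aᵢ) = aᵢ^(p^(kᵢ)+1)` for some
`kᵢ ≥ 1`. Then `{a₁, …, a_n}` is `p`-independent in `U` over the prime field `F_p`: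
no `aᵢ` lies in the subfield `U^p · F_p({a₁, …, a_n} ∖ {aᵢ})`. -/
theorem solutions_pIndependent
    {p : ℕ} (hp : p.Prime) {U : Type*} [Field U] [CharP U p]
    (d : Derivation ℤ U U) {n : ℕ} (a : Fin n → U)
    (hinj : Function.Injective a) (hne : ∀ i, a i ≠ 0)
    (k : Fin n → ℕ) (hk : ∀ i, 1 ≤ k i)
    (hd : ∀ i, d (a i) = a i ^ (p ^ k i + 1)) :
    ∀ i, a i ∉ Subfield.closure
      ((fun x : U => x ^ p) '' Set.univ ∪ ↑(⊥ : Subfield U)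
        ∪ (Set.range a \ {a i})) := by
  intro i hi
  have : Fact p.Prime := ⟨hp⟩
  have hd' : ∀ j, d (a j) = (a j ^ p ^ (k j - 1)) ^ p * a j := fun j => by
    rw [hd, ← pow_mul, ← pow_succ p, Nat.sub_add_cancel (hk j), pow_succ]
  set S : Set U := Set.range a \ {a i}
  have halg : ∀ x ∈ S, IsAlgebraic (frobenius U p).fieldRange x := fun x _ =>
    (isAlgebraic_algebraMap (⟨frobenius U p x, x, rfl⟩ : (frobenius U p).fieldRange)).of_pow
      hp.pos
  have hadj : a i ∈ IntermediateField.adjoin (frobenius U p).fieldRange S := by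
    refine (Subfield.closure_le (t := (IntermediateField.adjoin _ S).toSubfield)).2 ?_ hi
    refine Set.union_subset (Set.union_subset ?_ ?_) (IntermediateField.subset_adjoin _ S)
    · rintro _ ⟨x, -, rfl⟩
      exact (IntermediateField.adjoin _ S).algebraMap_mem
        (⟨frobenius U p x, x, rfl⟩ : (frobenius U p).fieldRange)
    · exact SetLike.coe_subset_coe.2 bot_le
  rw [← IntermediateField.mem_toSubalgebra,
    IntermediateField.adjoin_toSubalgebra_of_isAlgebraic halg, ← Subalgebra.mem_toSubmodule,
    Algebra.adjoin_eq_span] at hadj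
  refine hne i (d.eq_zero_of_mem_span_eigenvectors (hd' i) (Submodule.span_mono ?_ hadj))
  intro x hx
  have hmonomial : ∃ e : Fin n → ℤ, e i = 0 ∧
      d x = (∑ j, (e j : U) * a j ^ p ^ (k j - 1)) ^ p * x := by
    induction hx using Submonoid.closure_induction with
    | mem x hx =>
      obtain ⟨⟨j, rfl⟩, hj⟩ := hx
      have hij : i ≠ j := fun h => hj (h ▸ rfl)
      exact ⟨Pi.single j 1, by simp [hij], by simp [hd', Pi.single_apply]⟩
    | one => exact ⟨0, rfl, by simp [hp.ne_zero]⟩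
    | mul x y _ _ hx hy =>
      obtain ⟨e, he, hx⟩ := hx
      obtain ⟨f, hf, hy⟩ := hy
      refine ⟨e + f, by simp [he, hf], ?_⟩
      simp only [Pi.add_apply, Int.cast_add, add_mul, Finset.sum_add_distrib, add_pow_char,
        d.leibniz, hx, hy, smul_eq_mul]
      ring
  obtain ⟨e, he, hx⟩ := hmonomial
  refine ⟨_, fun h => ?_, hx⟩
  have hrel : ∑ j, ((Pi.single i 1 - e : Fin n → ℤ) j : U) * a j ^ p ^ (k j - 1) = 0 := by
    simp [sub_mul, Finset.sum_sub_distrib, h, Pi.single_apply]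
  simpa [he] using d.intCast_eq_zero_of_sum_mul_pow_eq_zero hinj hne hd' hrel i
end

section
/- Let p be a prime, let U be a field of characteristic p with a derivation ∂, and let a₁, …, a_n ∈ U be pairwise distinct nonzero elements such that ∂(a_i) = a_i^{p^{k_i}+1} for some integers k_i ≥ 1 (1 ≤ i ≤ n). Then a₁, …, a_n are algebraically independent over the prime field F_p. -/
/-- In a field, a vanishing sum of eigenvectors of a derivation with constant
eigenvalues vanishes eigenvalue by eigenvalue. -/
theorem Derivation.sum_filter_eigenvalue_eq_zero {U ι : Type*} [Field U] [DecidableEq U]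
    (d : Derivation ℤ U U) (s : Finset ι) (v l : ι → U)
    (hl : ∀ x ∈ s, d (l x) = 0) (hv : ∀ x ∈ s, d (v x) = l x * v x)
    (hsum : ∑ x ∈ s, v x = 0) (μ : U) :
    ∑ x ∈ s with l x = μ, v x = 0 := by
  have hpow (j : ℕ) : ∑ x ∈ s, l x ^ j * v x = 0 := by
    induction j with
    | zero => simpa using hsum
    | succ j ih =>
      have h := congrArg d ih
      rw [map_sum, map_zero] at h
      rw [← h]
      refine Finset.sum_congr rfl fun x hx => ?_
      rw [d.leibniz, d.leibniz_pow, hl x hx, hv x hx]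
      simp only [smul_eq_mul]
      ring
  have hpoly (f : Polynomial U) : ∑ x ∈ s, f.eval (l x) * v x = 0 := by
    simp_rw [Polynomial.eval_eq_sum_range, Finset.sum_mul]
    rw [Finset.sum_comm]
    refine Finset.sum_eq_zero fun j _ => ?_
    simp_rw [mul_assoc]
    rw [← Finset.mul_sum, hpow, mul_zero]
  let f : Polynomial U := ∏ ν ∈ (s.image l).erase μ, (Polynomial.X - Polynomial.C ν)
  have hμ : f.eval μ ≠ 0 := by
    rw [Polynomial.eval_prod, Finset.prod_ne_zero_iff]
    intro ν hν
    simpa [sub_eq_zero] using (Finset.ne_of_mem_erase hν).symm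
  have h := hpoly f
  rw [← Finset.sum_filter_add_sum_filter_not s (fun x => l x = μ)] at h
  have hnot : ∑ x ∈ s with ¬ l x = μ, f.eval (l x) * v x = 0 := by
    refine Finset.sum_eq_zero fun x hx => ?_
    obtain ⟨hxs, hx⟩ := Finset.mem_filter.mp hx
    have : f.eval (l x) = 0 := by
      rw [Polynomial.eval_prod]
      exact Finset.prod_eq_zero
        (Finset.mem_erase.mpr ⟨hx, Finset.mem_image_of_mem l hxs⟩) (by simp)
    rw [this, zero_mul]
  have heq : ∑ x ∈ s with l x = μ, f.eval (l x) * v x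
      = f.eval μ * ∑ x ∈ s with l x = μ, v x := by
    rw [Finset.mul_sum]
    exact Finset.sum_congr rfl fun x hx => by rw [(Finset.mem_filter.mp hx).2]
  rw [hnot, add_zero, heq] at h
  exact (mul_eq_zero.mp h).resolve_left hμ

theorem Derivation.apply_pow_char_pow {U : Type*} [CommRing U] {p : ℕ} [CharP U p]
    (d : Derivation ℤ U U) (x : U) {m : ℕ} (hm : m ≠ 0) : d (x ^ p ^ m) = 0 := by
  rw [d.leibniz_pow, ← Nat.cast_smul_eq_nsmul U]
  simp [hm]

theorem Derivation.apply_pow_char {U : Type*} [CommRing U] {p : ℕ} [CharP U p]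
    (d : Derivation ℤ U U) (x : U) : d (x ^ p) = 0 := by
  simp [d.leibniz_pow, ← Nat.cast_smul_eq_nsmul U]

theorem Derivation.apply_eq_zero_of_pow_char_eq_self {U : Type*} [CommRing U] {p : ℕ} [CharP U p]
    (d : Derivation ℤ U U) {c : U} (hc : c ^ p = c) : d c = 0 := by
  rw [← hc, d.apply_pow_char]

theorem pow_pow_eq_self {M : Type*} [Monoid M] {p : ℕ} {c : M} (hc : c ^ p = c) (m : ℕ) :
    c ^ p ^ m = c := by
  induction m with
  | zero => simp
  | succ m ih => rw [pow_succ, pow_mul, ih, hc]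

/-- A product of powers of eigenvectors of a derivation is an eigenvector. -/
theorem Derivation.apply_prod_pow_of_eigenvector {U ι : Type*} [CommRing U]
    (d : Derivation ℤ U U) (a l : ι → U) (h : ∀ i, d (a i) = l i * a i) (m : ι → ℕ)
    (s : Finset ι) :
    d (∏ i ∈ s, a i ^ m i) = (∑ i ∈ s, (m i : U) * l i) * ∏ i ∈ s, a i ^ m i := by
  classical
  have hp (i : ι) (j : ℕ) : d (a i ^ j) = (j : U) * l i * a i ^ j := by
    induction j with
    | zero => simp
    | succ j ih =>
      rw [pow_succ, d.leibniz, ih, h]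
      simp only [smul_eq_mul]
      push_cast
      ring
  induction s using Finset.induction_on with
  | empty => simp
  | insert i s hi ih =>
    rw [Finset.prod_insert hi, Finset.sum_insert hi, d.leibniz, ih, hp]
    simp only [smul_eq_mul]
    ring

section Solutions

variable {p : ℕ} [Fact p.Prime] {U : Type*} [Field U] [CharP U p] (d : Derivation ℤ U U)
  {n : ℕ} {a : Fin n → U} (hinj : Function.Injective a) (hne : ∀ i, a i ≠ 0)
  {k : Fin n → ℕ} (hk : ∀ i, 1 ≤ k i) (hd : ∀ i, d (a i) = a i ^ (p ^ k i + 1))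

include hinj hne hk hd

/-- The powers `aᵢ^(p^kᵢ)` of solutions of `d(aᵢ) = aᵢ^(p^(kᵢ)+1)` are linearly independent
over the prime field. -/
theorem solutions_pow_linearIndependent (c : Fin n → U) (hc : ∀ i, c i ^ p = c i)
    (s : Finset (Fin n)) (hsum : ∑ i ∈ s, c i * a i ^ p ^ k i = 0) : ∀ i ∈ s, c i = 0 := by
  classical
  induction s using Finset.strongInduction with
  | H s ih =>
  rcases s.eq_empty_or_nonempty with rfl | hs
  · simp
  obtain ⟨j, hjs, hj⟩ := s.exists_min_image k hs
  have hroot : ∑ i ∈ s, c i * a i ^ p ^ (k i - k j) = 0 := by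
    have h : (∑ i ∈ s, c i * a i ^ p ^ (k i - k j)) ^ p ^ k j = 0 := by
      rw [sum_pow_char_pow, ← hsum]
      refine Finset.sum_congr rfl fun i hi => ?_
      rw [mul_pow, pow_pow_eq_self (hc i), ← pow_mul, ← pow_add, Nat.sub_add_cancel (hj i hi)]
    exact eq_zero_of_pow_eq_zero h
  have hcj : c j = 0 := by
    have h := d.sum_filter_eigenvalue_eq_zero s (fun i => c i * a i ^ p ^ (k i - k j))
      (fun i => if k i = k j then a i ^ p ^ k j else 0)
      (fun i _ => by
        split_ifs
        · exact d.apply_pow_char_pow _ (by have := hk j; omega)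
        · exact map_zero d)
      (fun i hi => by
        have hij := hj i hi
        rw [d.leibniz, d.apply_eq_zero_of_pow_char_eq_self (hc i)]
        split_ifs with hkij
        · simp only [hkij, Nat.sub_self, pow_zero, pow_one, hd, smul_eq_mul]
          ring
        · rw [d.apply_pow_char_pow _ (by omega)]
          simp)
      hroot (a j ^ p ^ k j)
    have hfilter : {i ∈ s | (if k i = k j then a i ^ p ^ k j else 0) = a j ^ p ^ k j} = {j} := by
      ext i
      simp only [Finset.mem_filter, Finset.mem_singleton]
      constructor
      · rintro ⟨-, h⟩
        split_ifs at h
        · exact hinj (iterateFrobenius_inj U p (k j) h)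
        · exact absurd h.symm (pow_ne_zero _ (hne j))
      · rintro rfl
        simp [hjs]
    rw [hfilter] at h
    simpa [hne j] using h
  have herase := ih (s.erase j) (Finset.erase_ssubset hjs) (by
    rw [← hsum, ← Finset.add_sum_erase s _ hjs, hcj, zero_mul, zero_add])
  intro i hi
  by_cases hij : i = j
  · rw [hij, hcj]
  · exact herase i (Finset.mem_erase.mpr ⟨hij, hi⟩)

/-- Distinct monomials in the solutions of `d(aᵢ) = aᵢ^(p^(kᵢ)+1)` are linearly independent
over the prime field. -/
theorem solutions_monomials_linearIndependent {ι : Type*} (c : ι → U) (hc : ∀ x, c x ^ p = c x)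
    (N : ℕ) (s : Finset ι) (m : ι → Fin n → ℕ) (hm : Set.InjOn m s)
    (hN : ∀ x ∈ s, ∑ i, m x i ≤ N) (hsum : ∑ x ∈ s, c x * ∏ i, a i ^ m x i = 0) :
    ∀ x ∈ s, c x = 0 := by
  classical
  have hp : 2 ≤ p := (Fact.out : p.Prime).two_le
  induction N generalizing s m with
  | zero =>
    intro x hx
    have hzero (y : ι) (hy : y ∈ s) : m y = 0 := by
      have h := Nat.le_zero.mp (hN y hy)
      ext i
      exact Finset.sum_eq_zero_iff.mp h i (Finset.mem_univ i)
    have hs : s = {x} := Finset.eq_singleton_iff_unique_mem.mpr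
      ⟨hx, fun y hy => hm hy hx ((hzero y hy).trans (hzero x hx).symm)⟩
    rw [hs] at hsum
    simpa [hzero x hx] using hsum
  | succ N ih =>
    intro x hx
    let l (y : ι) : U := ∑ i, (m y i : U) * a i ^ p ^ k i
    have hconst (y : ι) : d (l y) = 0 := by
      rw [map_sum]
      refine Finset.sum_eq_zero fun i _ => ?_
      rw [d.leibniz, d.apply_pow_char_pow _ (by have := hk i; omega)]
      simp
    have hgroup := d.sum_filter_eigenvalue_eq_zero s (fun y => c y * ∏ i, a i ^ m y i) l
      (fun y _ => hconst y)
      (fun y _ => by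
        rw [d.leibniz, d.apply_eq_zero_of_pow_char_eq_self (hc y),
          d.apply_prod_pow_of_eigenvector a (fun i => a i ^ p ^ k i)
            (fun i => by rw [hd, pow_succ])]
        simp only [smul_eq_mul, l]
        ring)
      hsum (l x)
    have hmod (y : ι) (hy : l y = l x) (i : Fin n) : m y i % p = m x i % p := by
      have h := solutions_pow_linearIndependent d hinj hne hk hd
        (fun i => (m y i : U) - (m x i : U))
        (fun i => by
          rw [sub_pow_char]
          simp only [← frobenius_def, map_natCast])
        Finset.univ
        (by
          simp_rw [sub_mul]
          rw [Finset.sum_sub_distrib]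
          exact sub_eq_zero.mpr hy) i (Finset.mem_univ i)
      exact (CharP.natCast_eq_natCast U p).mp (sub_eq_zero.mp h)
    refine ih {y ∈ s | l y = l x} (fun y i => m y i / p) ?_ ?_ ?_ x (by simp [hx])
    · intro y hy z hz hyz
      simp only [Finset.coe_filter, Set.mem_ofPred_eq] at hy hz
      refine hm hy.1 hz.1 (funext fun i => ?_)
      rw [← Nat.div_add_mod (m y i) p, ← Nat.div_add_mod (m z i) p, hmod y hy.2, hmod z hz.2,
        show m y i / p = m z i / p from congrFun hyz i]
    · intro y hy
      have h : p * ∑ i, m y i / p ≤ N + 1 := by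
        refine le_trans ?_ (hN y (Finset.mem_filter.mp hy).1)
        rw [Finset.mul_sum]
        exact Finset.sum_le_sum fun i _ => Nat.mul_div_le _ _
      have := Nat.mul_le_mul_right (∑ i, m y i / p) hp
      omega
    · have h : (∏ i, a i ^ (m x i % p)) *
          (∑ y ∈ s with l y = l x, c y * ∏ i, a i ^ (m y i / p)) ^ p = 0 := by
        rw [sum_pow_char, Finset.mul_sum, ← hgroup]
        refine Finset.sum_congr rfl fun y hy => ?_
        rw [mul_pow, hc, ← Finset.prod_pow, mul_left_comm, ← Finset.prod_mul_distrib]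
        congr 1
        refine Finset.prod_congr rfl fun i _ => ?_
        rw [← hmod y (Finset.mem_filter.mp hy).2, ← pow_mul, ← pow_add, mul_comm _ p,
          Nat.mod_add_div]
      refine eq_zero_of_pow_eq_zero ((mul_eq_zero.mp h).resolve_left ?_)
      exact Finset.prod_ne_zero_iff.mpr fun i _ => pow_ne_zero _ (hne i)

end Solutions

/-- Let `U` be a field of characteristic `p` with a derivation `d`, and let
`a₁, …, a_n` be pairwise distinct nonzero elements with `d(aᵢ) = aᵢ^(p^(kᵢ)+1)` for some
`kᵢ ≥ 1`. Then `a₁, …, a_n` are algebraically independent over the prime field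
`F_p` (the bottom subfield of `U`). -/
theorem solutions_algebraicallyIndependent
    {p : ℕ} (hp : p.Prime) {U : Type*} [Field U] [CharP U p]
    (d : Derivation ℤ U U) {n : ℕ} (a : Fin n → U)
    (hinj : Function.Injective a) (hne : ∀ i, a i ≠ 0)
    (k : Fin n → ℕ) (hk : ∀ i, 1 ≤ k i)
    (hd : ∀ i, d (a i) = a i ^ (p ^ k i + 1)) :
    AlgebraicIndependent (⊥ : Subfield U) a := by
  have : Fact p.Prime := ⟨hp⟩
  rw [algebraicIndependent_iff]
  intro P hP
  rw [MvPolynomial.aeval_def, MvPolynomial.eval₂_eq'] at hP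
  ext x
  by_contra hx
  refine hx (solutions_monomials_linearIndependent d hinj hne hk hd
    (fun y => ((P.coeff y : (⊥ : Subfield U)) : U))
    (fun y => (Subfield.mem_bot_iff_pow_eq_self U p).mp (P.coeff y).2)
    (P.support.sup fun y => ∑ i, y i) P.support (fun y => y) DFunLike.coe_injective.injOn
    (fun y hy => Finset.le_sup (f := fun y : Fin n →₀ ℕ => ∑ i, y i) hy) hP x ?_)
  rw [MvPolynomial.mem_support_iff]
  exact fun h => hx (by simp [h])
end

section
/- Let p be a prime, let U be a field of characteristic p with a derivation ∂, and let n = p^k·m + 1 where k ≥ 1 and m is an integer not divisible by p. If a ∈ U satisfies ∂(a) = a^n, then the element b = m·a^m (where m denotes the image of the integer m in U) satisfies ∂(b) = b^{p^k + 1}. -/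
/-- Let `U` be a field of characteristic `p` with a derivation `d`, and let
`n = p^k · m + 1` with `k ≥ 1` and `m` an integer not divisible by `p`. If `a ∈ U`
satisfies `d(a) = a^n`, then `b = m · a^m` satisfies `d(b) = b^(p^k + 1)`. -/
theorem bernoulli_reduction
    {p : ℕ} (hp : p.Prime) {U : Type*} [Field U] [CharP U p]
    (d : Derivation ℤ U U) (k : ℕ) (hk : 1 ≤ k) (m : ℤ) (hm : ¬ (p : ℤ) ∣ m)
    (a : U) (ha : d a = a ^ ((p : ℤ) ^ k * m + 1)) :
    d ((m : U) * a ^ m) = ((m : U) * a ^ m) ^ (p ^ k + 1) := by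
  have := Fact.mk hp
  rcases eq_or_ne a 0 with rfl | ha0
  · have hm0 : m ≠ 0 := by
      rintro rfl
      exact hm (dvd_zero _)
    simp [zero_zpow m hm0]
  · have hfrob : (m : U) ^ p ^ k = m := by
      rw [← iterateFrobenius_def, map_intCast]
    have hpow : a ^ (m - 1) * a ^ ((p : ℤ) ^ k * m + 1) = a ^ m * (a ^ m) ^ p ^ k := by
      rw [← zpow_natCast (a ^ m), ← zpow_mul, ← zpow_add₀ ha0, ← zpow_add₀ ha0]
      congr 1
      push_cast
      ring
    have hd : d (a ^ m) = m * (a ^ (m - 1) * d a) := by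
      simp [Derivation.leibniz_zpow]
    rw [← zsmul_eq_mul, map_zsmul, hd, ha, hpow, zsmul_eq_mul, zsmul_eq_mul, pow_succ, mul_pow, hfrob]
    ring
end
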